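/- arXiv:2201.03944 — 7 statements merged into one kernel-verified Lean document; each statement's English description precedes it below -/
import Mathlib

section
/- Let k ≥ 2 and δ > (k−2)/(k−1); set δ′ = δ − (k−2)/(k−1). There exists n₀ (depending only on δ′ and k) such that for every n ≥ n₀, every graph G on n vertices with minimum degree δ(G) ≥ δn has at most 2·δ′^{−k} tight components in K_k(G). -/
open scoped Classical

namespace Paper

noncomputable section

variable {V : Type} [Fintype V]

/-- The degree of a vertex, via `Set.ncard`. -/
def ndeg (G : SimpleGraph V) (v : V) : ℕ := (G.neighborSet v).ncard

/-- A proper colouring with colours `0, …, k-1`. -/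
def ProperCol (G : SimpleGraph V) (k : ℕ) (C : V → ℕ) : Prop :=
  (∀ v, C v < k) ∧ ∀ ⦃u v⦄, G.Adj u v → C u ≠ C v

/-- A topological colouring with colours `0, …, k-1`: every edge is monochromatic. -/
def TopCol (G : SimpleGraph V) (k : ℕ) (C : V → ℕ) : Prop :=
  (∀ v, C v < k) ∧ ∀ ⦃u v⦄, G.Adj u v → C u = C v

/-- The size of the `i`-th colour class of a colouring. -/
def classCard (C : V → ℕ) (i : ℕ) : ℕ := {v | C v = i}.ncard

/-- The chromatic number, as a natural number. -/
def chromNum (G : SimpleGraph V) : ℕ := G.chromaticNumber.toNat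

/-- The size of the smallest colour class of a colouring with `k` colours. -/
def minClassCard (C : V → ℕ) (k : ℕ) : ℕ := sInf {a | ∃ i < k, a = classCard C i}

/-- The minimum, over proper `χ(G)`-colourings, of the size of the smallest colour class. -/
def alphaNat (G : SimpleGraph V) : ℕ :=
  sInf {a | ∃ C, ProperCol G (chromNum G) C ∧ a = minClassCard C (chromNum G)}

/-- `α(G)`: minimum proportion of vertices in a single colour class over proper
`χ(G)`-colourings. -/
def alphaR (G : SimpleGraph V) : ℝ := (alphaNat G : ℝ) / (Fintype.card V : ℝ)

/-- The critical chromatic number `crit(G) = (χ(G) − 1)/(1 − α(G))`. -/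
def critR (G : SimpleGraph V) : ℝ := ((chromNum G : ℝ) - 1) / (1 - alphaR G)

/-- `𝒟(G)`: values `||φ⁻¹(0)| − |φ⁻¹(1)||` over proper `χ(G)`-colourings `φ`. -/
def DSet (G : SimpleGraph V) : Set ℕ :=
  {d | ∃ C, ProperCol G (chromNum G) C ∧
    d = ((classCard C 0 : ℤ) - (classCard C 1 : ℤ)).natAbs}

/-- The set `S ⊆ ℕ` has greatest common divisor `1`.  (Elements `0` are immaterial, and this
fails when `S ⊆ {0}`, matching the convention `gcd = ∞` in that case.) -/
def GcdOne (S : Set ℕ) : Prop := ∃ T : Finset ℕ, ↑T ⊆ S ∧ T.gcd id = 1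

/-- The orders of the connected components of `G`. -/
def compOrders (G : SimpleGraph V) : Set ℕ :=
  {m | ∃ c : G.ConnectedComponent, m = c.supp.ncard}

/-- Membership in the class `𝓕_cr`. -/
def IsFcr (G : SimpleGraph V) : Prop :=
  (G.chromaticNumber = 2 ∧ GcdOne (DSet G) ∧ GcdOne (compOrders G)) ∨
  (3 ≤ G.chromaticNumber ∧ GcdOne (DSet G))

/-- `H` is a tiling whose tiles satisfy the (isomorphism-invariant) predicate `tile`:
the vertex set partitions into parts with no edges of `H` between distinct parts, each part
inducing a graph satisfying `tile`. -/
def IsTiling (H : SimpleGraph V) (tile : ∀ (W : Type) [Fintype W], SimpleGraph W → Prop) : Prop :=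
  ∃ P : Set (Set V), Setoid.IsPartition P ∧
    (∀ p ∈ P, ∀ q ∈ P, p ≠ q → ∀ u ∈ p, ∀ v ∈ q, ¬ H.Adj u v) ∧
    ∀ p ∈ P, tile ↥p (H.induce p)

/-- Tiles of order at most `w`. -/
def TileLe (w : ℕ) (W : Type) [Fintype W] (F : SimpleGraph W) : Prop := Fintype.card W ≤ w

/-- Tiles in `𝓕(k, w)`: properly `k`-colourable of order at most `w` (real bound `w`). -/
def TileCol (k : ℕ) (w : ℝ) (W : Type) [Fintype W] (F : SimpleGraph W) : Prop :=
  F.Colorable k ∧ (Fintype.card W : ℝ) ≤ w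

/-- Tiles in `𝓕_cr(k, w)` (real bound `w`). -/
def TileFcr (k : ℕ) (w : ℝ) (W : Type) [Fintype W] (F : SimpleGraph W) : Prop :=
  IsFcr F ∧ F.Colorable k ∧ (Fintype.card W : ℝ) ≤ w

/-- Tiles in `𝓕_c(k, w)` (real bound `w`). -/
def TileFc (k : ℕ) (w : ℝ) (W : Type) [Fintype W] (F : SimpleGraph W) : Prop :=
  GcdOne (compOrders F) ∧ F.Colorable k ∧ (Fintype.card W : ℝ) ≤ w

/-- Tiles isomorphic to a fixed graph `F₀`. -/
def TileIso {m : ℕ} (F₀ : SimpleGraph (Fin m)) (W : Type) [Fintype W]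
    (F : SimpleGraph W) : Prop :=
  Nonempty (F ≃g F₀)

/-- `G` contains a copy of `H` as a (not necessarily induced) subgraph. -/
def ContainsCopy {V' : Type} (G : SimpleGraph V) (H : SimpleGraph V') : Prop :=
  ∃ f : V' → V, Function.Injective f ∧ ∀ ⦃u v⦄, H.Adj u v → G.Adj (f u) (f v)

/-- `H` is properly `(k, s)`-flexi-chromatic. -/
def ProperlyFlexi (H : SimpleGraph V) (k s : ℕ) : Prop :=
  ∃ φ, ProperCol H k φ ∧ ∀ w : Fin k → ℤ, ∑ i, w i = 0 → (∀ i, |w i| ≤ (s : ℤ)) →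
    ∃ φ', ProperCol H k φ' ∧
      ∀ i : Fin k, (classCard φ (i : ℕ) : ℤ) - classCard φ' (i : ℕ) = w i

/-- `H` is topologically `(k, s)`-flexi-chromatic. -/
def TopFlexi (H : SimpleGraph V) (k s : ℕ) : Prop :=
  ∃ φ, TopCol H k φ ∧ ∀ w : Fin k → ℤ, ∑ i, w i = 0 → (∀ i, |w i| ≤ (s : ℤ)) →
    ∃ φ', TopCol H k φ' ∧
      ∀ i : Fin k, (classCard φ (i : ℕ) : ℤ) - classCard φ' (i : ℕ) = w i

/-- `A` is a union of connected components of `H` (the vertex set of a subtiling). -/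
def CompClosed (H : SimpleGraph V) (A : Set V) : Prop :=
  ∀ ⦃u v⦄, H.Reachable u v → u ∈ A → v ∈ A

/-- `H` contains `t` pairwise disjoint properly `(k, s)`-flexi-chromatic subtilings together
with one further disjoint topologically `(ℓ, s')`-flexi-chromatic subtiling, each of order at
most `w'`. -/
def HasFlexiSubtilings (H : SimpleGraph V) (t ℓ k s s' w' : ℕ) : Prop :=
  ∃ (A : Fin t → Set V) (B : Set V),
    (∀ i, CompClosed H (A i)) ∧ CompClosed H B ∧
    (∀ i j, i ≠ j → Disjoint (A i) (A j)) ∧ (∀ i, Disjoint (A i) B) ∧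
    (∀ i, (A i).ncard ≤ w') ∧ B.ncard ≤ w' ∧
    (∀ i, ProperlyFlexi (H.induce (A i)) k s) ∧
    TopFlexi (H.induce B) ℓ s'

/-- `H ∈ ℋ(n, w, Δ; χ; t, ℓ, w')`. -/
def InH (H : SimpleGraph V) (n w : ℕ) (Δ χ : ℝ) (t ℓ w' : ℕ) : Prop :=
  Fintype.card V ≤ n ∧ (∀ v, (ndeg H v : ℝ) ≤ Δ) ∧ IsTiling H (TileLe w) ∧
  critR H ≤ χ ∧ HasFlexiSubtilings H t ℓ ⌈χ⌉₊ (⌈χ⌉₊ * w) w w'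

/-- The tight adjacency graph `T(J)` on the edge set `E` of a `k`-uniform hypergraph. -/
def TGraph (k : ℕ) (E : Set (Finset V)) : SimpleGraph ↥E :=
  SimpleGraph.fromRel fun e f => ((e : Finset V) ∩ (f : Finset V)).card = k - 1

/-- The number of tight components. -/
def tightCount (k : ℕ) (E : Set (Finset V)) : ℕ := Nat.card (TGraph k E).ConnectedComponent

/-- The vertex support of a tight component. -/
def tcSupp (k : ℕ) (E : Set (Finset V)) (c : (TGraph k E).ConnectedComponent) : Set V :=
  {v | ∃ e : ↥E, (TGraph k E).connectedComponentMk e = c ∧ v ∈ (e : Finset V)}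

/-- The loose adjacency graph `L(J)` on the tight components. -/
def LGraph (k : ℕ) (E : Set (Finset V)) : SimpleGraph (TGraph k E).ConnectedComponent :=
  SimpleGraph.fromRel fun c c' => (tcSupp k E c ∩ tcSupp k E c').Nonempty

/-- The number of loose components. -/
def looseCount (k : ℕ) (E : Set (Finset V)) : ℕ := Nat.card (LGraph k E).ConnectedComponent

/-- `(t, ℓ)`-connectedness: some vertex-spanning subhypergraph has at most `t` tight
components and at most `ℓ` loose components. -/
def ConnectedTL (k : ℕ) (E : Set (Finset V)) (t ℓ : ℕ) : Prop :=
  ∃ E' ⊆ E, (∀ v : V, ∃ e ∈ E', v ∈ e) ∧ tightCount k E' ≤ t ∧ looseCount k E' ≤ ℓ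

/-- Every vertex is linked to some edge. -/
def Linked (k : ℕ) (E : Set (Finset V)) : Prop :=
  ∀ v : V, ∃ f ∈ E, v ∉ f ∧ ∃ e ∈ E, v ∈ e ∧ (e ∩ f).card = k - 1

/-- `ω` is a fractional `F`-tiling of `G`. -/
def IsFracTiling {α : Type} [Fintype α] (F : SimpleGraph α) (G : SimpleGraph V)
    (ω : (F →g G) → ℝ) : Prop :=
  (∀ θ, 0 ≤ ω θ ∧ ω θ ≤ 1) ∧
  ∀ v : V, (∑ᶠ θ : F →g G, ω θ * ({u | θ u = v}.ncard : ℝ)) ≤ 1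

/-- The weight of a fractional tiling. -/
def fracWeight {α : Type} [Fintype α] (F : SimpleGraph α) (G : SimpleGraph V)
    (ω : (F →g G) → ℝ) : ℝ :=
  (Fintype.card α : ℝ) * ∑ᶠ θ : F →g G, ω θ

/-- For a rational `q > 1`, the numerator `a` in `q = ⌊q⌋ + a/b`. -/
def aB (q : ℚ) : ℕ := (q - (⌊q⌋ : ℚ)).num.toNat

/-- For a rational `q > 1`, the denominator `b` in `q = ⌊q⌋ + a/b`. -/
def bB (q : ℚ) : ℕ := (q - (⌊q⌋ : ℚ)).den

/-- The bottle graph `B_q`: complete `⌈q⌉`-partite with one part of size `a` and the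
remaining `⌈q⌉ − 1` parts of size `b`. -/
def Bgraph (q : ℚ) : SimpleGraph (Σ i : Fin ⌈q⌉₊, Fin (if (i : ℕ) = 0 then aB q else bB q)) :=
  SimpleGraph.completeMultipartiteGraph fun i : Fin ⌈q⌉₊ => Fin (if (i : ℕ) = 0 then aB q else bB q)

/-- `G` is a `(q, ρ; t, ℓ)`-tiling framework. -/
def TilingFramework (G : SimpleGraph V) (q : ℚ) (ρ : ℝ) (t ℓ : ℕ) : Prop :=
  (∃ ω, IsFracTiling (Bgraph q) G ω ∧
      (1 - ρ) * (Fintype.card V : ℝ) ≤ fracWeight (Bgraph q) G ω) ∧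
  ConnectedTL ⌈q⌉₊ (G.cliqueSet ⌈q⌉₊) t ℓ ∧
  Linked ⌈q⌉₊ (G.cliqueSet ⌈q⌉₊)

/-- `G'` (on the vertex set `S`) is an `(ε, d)`-approximation of `G`. -/
def IsApprox (G : SimpleGraph V) (ε d : ℝ) (S : Set V) (G' : SimpleGraph ↥S) : Prop :=
  G' ≤ G.induce S ∧ (1 - ε) * (Fintype.card V : ℝ) ≤ (S.ncard : ℝ) ∧
  ∀ v : ↥S, (ndeg G (v : V) : ℝ) - d * (Fintype.card V : ℝ) ≤ (ndeg G' v : ℝ)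

/-- `G` is `μ`-robustly a `(q, ρ; t, ℓ)`-tiling framework. -/
def RobustFramework (G : SimpleGraph V) (μ : ℝ) (q : ℚ) (ρ : ℝ) (t ℓ : ℕ) : Prop :=
  ∀ (S : Set V) (G' : SimpleGraph ↥S), IsApprox G μ μ S G' → TilingFramework G' q ρ t ℓ

/-- `α(χ) = 1 − (⌈χ⌉ − 1)/χ`. -/
def alphaOf (χ : ℝ) : ℝ := 1 - ((⌈χ⌉₊ : ℝ) - 1) / χ

/-- The degree sequence of `G` is `(χ, μ)`-strong. -/
def DegSeqStrong (G : SimpleGraph V) (χ μ : ℝ) : Prop :=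
  ∃ e : Fin (Fintype.card V) ≃ V,
    (∀ i j, i ≤ j → ndeg G (e i) ≤ ndeg G (e j)) ∧
    ∀ i : Fin (Fintype.card V), ((i : ℕ) + 1 : ℝ) ≤ (Fintype.card V : ℝ) / χ →
      (1 - 1 / χ - alphaOf χ) * (Fintype.card V : ℝ) + χ * alphaOf χ * ((i : ℕ) + 1) +
          μ * (Fintype.card V : ℝ) ≤ (ndeg G (e i) : ℝ)

/-- `G` is uniformly `(ρ, d)`-dense. -/
def UniformlyDense (G : SimpleGraph V) (ρ d : ℝ) : Prop :=
  ∀ U : Set V, d * (U.ncard : ℝ) ^ 2 / 2 - ρ * (Fintype.card V : ℝ) ^ 2 ≤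
    ((G.induce U).edgeSet.ncard : ℝ)

/-- `p`-approximately `(k, s)`-flexi-chromatic with central colouring `φ`, generic in the
kind of colouring `Col` (proper or topological). -/
def ApproxFlexiWith {V : Type} (Col : ℕ → (V → ℕ) → Prop) (k s p : ℕ) (φ : V → ℕ) : Prop :=
  Col k φ ∧ ∀ w : Fin k → ℤ, ∑ i, w i = 0 → (∀ i, |w i| ≤ (s : ℤ)) →
    ∃ φ', Col k φ' ∧
      ∀ i : Fin k, |(classCard φ (i : ℕ) : ℤ) - classCard φ' (i : ℕ) - w i| ≤ (p : ℤ)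

/-- The vertex support of a hypergraph edge set. -/
def hsupp (E : Set (Finset V)) : Set V := {v | ∃ e ∈ E, v ∈ e}

/-- The reachability graph `ℛ(T)` on the vertex set of `T`. -/
def RGraph (k : ℕ) (T : Set (Finset V)) : SimpleGraph ↥(hsupp T) :=
  SimpleGraph.fromRel fun x y => ∃ e ∈ T, ∃ f ∈ T,
    (x : V) ∈ e ∧ (x : V) ∉ f ∧ (y : V) ∈ f ∧ (y : V) ∉ e ∧ (e ∩ f).card = k - 1

end

/-- The common neighbourhood of `m` vertices misses at most `m (1 - δ) |V|` vertices when every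
vertex has degree at least `δ |V|`. -/
lemma le_card_common_neighbors {V : Type} [Fintype V] (G : SimpleGraph V) {δ : ℝ}
    (hdeg : ∀ v, δ * Fintype.card V ≤ (ndeg G v : ℝ)) (Q : Finset V) :
    (1 - Q.card * (1 - δ)) * Fintype.card V ≤
      ({x | ∀ q ∈ Q, G.Adj x q}.ncard : ℝ) := by
  have hset : {x | ∀ q ∈ Q, G.Adj x q}.ncard =
      (Finset.univ.filter fun x => ∀ q ∈ Q, G.Adj x q).card := by
    rw [← Set.ncard_coe_finset]
    simp
  rw [hset]
  have hnon : ∀ q : V, ((Finset.univ.filter fun x => ¬ G.Adj x q).card : ℝ) ≤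
      (1 - δ) * Fintype.card V := by
    intro q
    have h1 := Finset.card_filter_add_card_filter_not (s := (Finset.univ : Finset V))
      (fun x => G.Adj x q)
    have h2 : ndeg G q = (Finset.univ.filter fun x => G.Adj x q).card := by
      rw [ndeg, ← Set.ncard_coe_finset]
      congr 1
      ext x
      simp [G.adj_comm]
    have h3 := hdeg q
    rw [h2] at h3
    rw [Finset.card_univ] at h1
    have h4 : ((Finset.univ.filter fun x => G.Adj x q).card : ℝ) +
      (Finset.univ.filter fun x => ¬ G.Adj x q).card = Fintype.card V := by exact_mod_cast h1
    linarith
  have hsplit := Finset.card_filter_add_card_filter_not (s := (Finset.univ : Finset V))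
    (fun x => ∀ q ∈ Q, G.Adj x q)
  have hunion : (Finset.univ.filter fun x => ¬ ∀ q ∈ Q, G.Adj x q).card ≤
      ∑ q ∈ Q, (Finset.univ.filter fun x => ¬ G.Adj x q).card := by
    refine le_trans (Finset.card_le_card ?_) Finset.card_biUnion_le
    intro x hx
    simpa using hx
  have hsum : ((Finset.univ.filter fun x => ¬ ∀ q ∈ Q, G.Adj x q).card : ℝ) ≤
      Q.card * ((1 - δ) * Fintype.card V) := by
    calc _ ≤ ∑ q ∈ Q, ((Finset.univ.filter fun x => ¬ G.Adj x q).card : ℝ) := by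
          exact_mod_cast hunion
      _ ≤ ∑ _q ∈ Q, (1 - δ) * Fintype.card V := Finset.sum_le_sum fun q _ => hnon q
      _ = _ := by rw [Finset.sum_const, nsmul_eq_mul]
  rw [Finset.card_univ] at hsplit
  have hsplit' : ((Finset.univ.filter fun x => ∀ q ∈ Q, G.Adj x q).card : ℝ) +
    (Finset.univ.filter fun x => ¬ ∀ q ∈ Q, G.Adj x q).card = Fintype.card V := by
      exact_mod_cast hsplit
  linarith

/-- The orderings of the edges of a tight component. -/
def orderedEdges {V : Type} (k : ℕ) (E : Set (Finset V))
    (c : (TGraph k E).ConnectedComponent) : Set (Fin k → V) :=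
  {w | ∃ h : Finset.univ.image w ∈ E, (TGraph k E).connectedComponentMk ⟨_, h⟩ = c}

/-- Replacing one vertex of a clique by a common neighbour of the others does not leave the
tight component. -/
lemma update_mem_orderedEdges {V : Type} {k : ℕ} {G : SimpleGraph V}
    {c : (TGraph k (G.cliqueSet k)).ConnectedComponent} {w : Fin k → V}
    (hw : w ∈ orderedEdges k (G.cliqueSet k) c) {j : Fin k} {x : V}
    (hx : ∀ q ∈ (Finset.univ.erase j).image w, G.Adj x q) :
    Function.update w j x ∈ orderedEdges k (G.cliqueSet k) c := by
  obtain ⟨hE, hc⟩ := hw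
  have hN : G.IsNClique k (Finset.univ.image w) := hE
  set Q := (Finset.univ.erase j).image w with hQ
  have hinj : Function.Injective w := by
    rw [← Set.injOn_univ, ← Finset.coe_univ, ← Finset.card_image_iff, hN.card_eq]
    simp
  have himage : Finset.univ.image w = insert (w j) Q := by
    rw [hQ, ← Finset.image_insert, Finset.insert_erase (Finset.mem_univ j)]
  have hwj : w j ∉ Q := by
    simp [hQ, hinj.eq_iff]
  have hQcard : Q.card = k - 1 := by
    rw [hQ, Finset.card_image_of_injective _ hinj, Finset.card_erase_of_mem (Finset.mem_univ j)]
    simp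
  have hxQ : x ∉ Q := fun h => G.loopless.irrefl x (hx x h)
  have himage' : Finset.univ.image (Function.update w j x) = insert x Q := by
    rw [← Finset.insert_erase (Finset.mem_univ j), Finset.image_insert, Function.update_self, hQ]
    congr 1
    refine Finset.image_congr fun i hi => ?_
    simp at hi
    simp [hi]
  have hk : k - 1 + 1 = k := Nat.sub_add_cancel j.pos
  have hQclique : G.IsNClique (k - 1) Q :=
    ⟨hN.isClique.subset (by rw [himage]; simp), hQcard⟩
  have hE' : Finset.univ.image (Function.update w j x) ∈ G.cliqueSet k := by
    rw [himage', SimpleGraph.mem_cliqueSet_iff, ← hk]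
    exact hQclique.insert hx
  refine ⟨hE', ?_⟩
  rw [← hc]
  by_cases hxw : x = w j
  · subst hxw
    simp
  · refine (SimpleGraph.ConnectedComponent.eq.2 (SimpleGraph.Adj.reachable ?_)).symm
    rw [TGraph, SimpleGraph.fromRel_adj]
    refine ⟨fun h => ?_, Or.inl ?_⟩
    · have h' := congrArg Subtype.val h
      simp only [himage, himage'] at h'
      have : x ∈ insert (w j) Q := h' ▸ Finset.mem_insert_self x Q
      simp [hxw, hxQ] at this
    · simp only [himage, himage']
      rw [Finset.insert_inter_of_notMem (by simp [hwj, Ne.symm hxw]),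
        Finset.inter_insert_of_notMem hxQ, Finset.inter_self, hQcard]

/-- If every `k - 1` vertices have at least `d` common neighbours, then every tight component
of the `k`-clique hypergraph has at least `d ^ k` ordered edges. -/
lemma pow_le_card_orderedEdges {V : Type} [Fintype V] {k : ℕ} {G : SimpleGraph V} {d : ℝ}
    (hd : 0 ≤ d)
    (hcommon : ∀ Q : Finset V, Q.card ≤ k - 1 →
      d ≤ ({x | ∀ q ∈ Q, G.Adj x q}.ncard : ℝ))
    (c : (TGraph k (G.cliqueSet k)).ConnectedComponent) :
    d ^ k ≤ ((orderedEdges k (G.cliqueSet k) c).toFinset.card : ℝ) := by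
  obtain ⟨⟨e, he⟩, hec⟩ := c.exists_rep
  have hecard : e.card = k := SimpleGraph.IsNClique.card_eq he
  obtain ⟨v, hv⟩ : ∃ v : Fin k → V, Finset.univ.image v = e := by
    refine ⟨fun i => ((e.equivFinOfCardEq hecard).symm i : V), ?_⟩
    ext x
    simp only [Finset.mem_image, Finset.mem_univ, true_and]
    constructor
    · rintro ⟨i, rfl⟩
      exact Subtype.coe_prop _
    · exact fun hx => ⟨e.equivFinOfCardEq hecard ⟨x, hx⟩, by simp⟩
  subst hv
  set S := (orderedEdges k (G.cliqueSet k) c).toFinset with hS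
  let A : ℕ → Finset (Fin k → V) := fun j => S.filter fun w => ∀ i : Fin k, j ≤ i → w i = v i
  have key : ∀ j ≤ k, d ^ j ≤ ((A j).card : ℝ) := by
    intro j
    induction j with
    | zero =>
      intro _
      have : v ∈ A 0 := by
        simp only [A, Finset.mem_filter, hS, Set.mem_toFinset]
        exact ⟨⟨he, hec⟩, fun _ _ => trivial⟩
      have : 1 ≤ (A 0).card := Finset.card_pos.2 ⟨v, this⟩
      rw [pow_zero]
      exact_mod_cast this
    | succ j ih =>
      intro hj
      let jj : Fin k := ⟨j, hj⟩
      let X : (Fin k → V) → Finset V := fun w =>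
        Finset.univ.filter fun x => ∀ q ∈ (Finset.univ.erase jj).image w, G.Adj x q
      have hX : ∀ w, d ≤ ((X w).card : ℝ) := fun w => by
        have h := hcommon ((Finset.univ.erase jj).image w) (Finset.card_image_le.trans (by simp))
        rwa [Set.ncard_eq_toFinset_card', Set.toFinset_ofFinset] at h
      have hcard : ((A j).sigma X).card ≤ (A (j + 1)).card := by
        refine Finset.card_le_card_of_injOn (fun p => Function.update p.1 jj p.2) ?_ ?_
        · rintro ⟨w, x⟩ hp
          simp only [Finset.mem_coe, Finset.mem_sigma, A, X, Finset.mem_filter, hS,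
            Set.mem_toFinset, Finset.mem_univ, true_and] at hp ⊢
          refine ⟨update_mem_orderedEdges hp.1.1 hp.2, fun i hi => ?_⟩
          have : i ≠ jj := fun h => by
            subst h
            exact absurd hi (by simp [jj])
          rw [Function.update_of_ne this]
          exact hp.1.2 i (by omega)
        · rintro ⟨w, x⟩ hp ⟨w', x'⟩ hp' h
          simp only [Finset.mem_coe, Finset.mem_sigma, A, Finset.mem_filter] at hp hp'
          dsimp only at h
          have hx : x = x' := by simpa using congrFun h jj
          have hw : w = w' := by
            funext i
            by_cases hi : i = jj
            · subst hi
              rw [hp.1.2 jj le_rfl, hp'.1.2 jj le_rfl]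
            · simpa [hi] using congrFun h i
          rw [hx, hw]
      calc d ^ (j + 1) = d ^ j * d := pow_succ d j
        _ ≤ (A j).card * d := mul_le_mul_of_nonneg_right (ih (by omega)) hd
        _ = ∑ _w ∈ A j, d := by rw [Finset.sum_const, nsmul_eq_mul]
        _ ≤ ∑ w ∈ A j, ((X w).card : ℝ) := Finset.sum_le_sum fun w _ => hX w
        _ = (((A j).sigma X).card : ℝ) := by rw [Finset.card_sigma]; push_cast; rfl
        _ ≤ _ := by exact_mod_cast hcard
  refine (key k le_rfl).trans ?_
  exact_mod_cast Finset.card_le_card (Finset.filter_subset _ _)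

/-- If every `k - 1` vertices have at least `d` common neighbours, then the `k`-clique
hypergraph has at most `(|V| / d) ^ k` tight components. -/
lemma tightCount_mul_pow_le {V : Type} [Fintype V] {k : ℕ} {G : SimpleGraph V} {d : ℝ}
    (hd : 0 ≤ d)
    (hcommon : ∀ Q : Finset V, Q.card ≤ k - 1 →
      d ≤ ({x | ∀ q ∈ Q, G.Adj x q}.ncard : ℝ)) :
    (tightCount k (G.cliqueSet k) : ℝ) * d ^ k ≤ (Fintype.card V : ℝ) ^ k := by
  let S := fun c => (orderedEdges k (G.cliqueSet k) c).toFinset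
  have : Fintype (TGraph k (G.cliqueSet k)).ConnectedComponent := Fintype.ofFinite _
  have hdisj : ((Finset.univ : Finset (TGraph k (G.cliqueSet k)).ConnectedComponent) :
      Set _).PairwiseDisjoint S := by
    intro c _ c' _ hne
    refine Finset.disjoint_left.2 fun w hw hw' => hne ?_
    obtain ⟨_, h⟩ := Set.mem_toFinset.1 hw
    obtain ⟨_, h'⟩ := Set.mem_toFinset.1 hw'
    exact h.symm.trans h'
  have hle : ∑ c, (S c).card ≤ Fintype.card V ^ k := by
    rw [← Finset.card_biUnion hdisj]
    exact (Finset.card_le_univ _).trans (by simp)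
  calc (tightCount k (G.cliqueSet k) : ℝ) * d ^ k
      = ∑ _c : (TGraph k (G.cliqueSet k)).ConnectedComponent, d ^ k := by
        rw [Finset.sum_const, nsmul_eq_mul, Finset.card_univ, tightCount,
          Nat.card_eq_fintype_card]
    _ ≤ ∑ c, ((S c).card : ℝ) :=
        Finset.sum_le_sum fun c _ => pow_le_card_orderedEdges hd hcommon c
    _ ≤ _ := by exact_mod_cast hle

/-- Corollary 5.4 (bounded number of tight components). -/
theorem reachability_components (k : ℕ) (hk : 2 ≤ k) (δ : ℝ)
    (hδk : ((k : ℝ) - 2) / ((k : ℝ) - 1) < δ) :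
    ∃ n₀ : ℕ, ∀ n : ℕ, n₀ ≤ n → ∀ G : SimpleGraph (Fin n),
      (∀ v, δ * n ≤ (ndeg G v : ℝ)) →
      (tightCount k (G.cliqueSet k) : ℝ) ≤
        2 / (δ - ((k : ℝ) - 2) / ((k : ℝ) - 1)) ^ k := by
  have hk2 : (2 : ℝ) ≤ k := by exact_mod_cast hk
  set δ' := δ - ((k : ℝ) - 2) / ((k : ℝ) - 1) with hδ'
  have hpos : 0 < δ' := sub_pos.2 hδk
  refine ⟨1, fun n hn G hdeg => ?_⟩
  have hn0 : (0 : ℝ) < n := by exact_mod_cast hn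
  have hmin : 1 - ((k : ℝ) - 1) * (1 - δ) = (k - 1) * δ' := by
    have : (k : ℝ) - 1 ≠ 0 := by linarith
    rw [hδ']
    field_simp
    ring
  have hδ1 : δ ≤ 1 := by
    have h := hdeg ⟨0, hn⟩
    have h' : ndeg G ⟨0, hn⟩ ≤ n := by
      simpa [ndeg] using Set.ncard_le_card (G.neighborSet ⟨0, hn⟩)
    have h'' : (ndeg G ⟨0, hn⟩ : ℝ) ≤ n := by exact_mod_cast h'
    by_contra! hlt
    nlinarith
  have hcommon : ∀ Q : Finset (Fin n), Q.card ≤ k - 1 →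
      δ' * n ≤ ({x | ∀ q ∈ Q, G.Adj x q}.ncard : ℝ) := by
    intro Q hQ
    have hQ' : (Q.card : ℝ) ≤ k - 1 := by
      have : Q.card + 1 ≤ k := by omega
      have : (Q.card : ℝ) + 1 ≤ k := by exact_mod_cast this
      linarith
    have h := le_card_common_neighbors G (δ := δ) (by simpa using hdeg) Q
    rw [Fintype.card_fin] at h
    refine le_trans (mul_le_mul_of_nonneg_right ?_ hn0.le) h
    nlinarith
  have h := tightCount_mul_pow_le (by positivity) hcommon
  rw [Fintype.card_fin, mul_pow, ← mul_assoc] at h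
  have h1 := le_of_mul_le_mul_right (h.trans_eq (one_mul _).symm) (pow_pos hn0 k)
  rw [le_div_iff₀ (pow_pos hpos k)]
  linarith

end Paper
end

section
/- Let k ≥ 2 and let G be a graph on n vertices with minimum degree δ(G) = δn > ((k−2)/(k−1))n + 1. Then every vertex of G is linked in K_k(G); that is, for every vertex v of G there exist a k-clique K of G with v ∉ V(K) and an edge e of K_k(G) containing v with |e ∩ V(K)| = k−1. -/
open scoped Classical

namespace Paper

/-- The common neighbourhood of a vertex set `A` has at least `|V| - |A| (|V| - d)` elements
when all degrees are at least `d`. -/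
theorem card_add_mul_le_card_commonNeighbors {V : Type*} [Fintype V] (G : SimpleGraph V) [DecidableRel G.Adj] (d : ℕ)
    (hd : ∀ v, d ≤ G.degree v) (A : Finset V) :
    Fintype.card V + A.card * d ≤
      (Finset.univ.filter fun x => ∀ a ∈ A, G.Adj a x).card + A.card * Fintype.card V := by
  induction A using Finset.induction_on with
  | empty => simp
  | insert a A ha ih =>
    rw [Finset.card_insert_of_notMem ha]
    have key : (Finset.univ.filter fun x => ∀ b ∈ insert a A, G.Adj b x) =
        (Finset.univ.filter fun x => ∀ b ∈ A, G.Adj b x) ∩ G.neighborFinset a := by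
      ext x
      simp [and_comm]
    rw [key]
    have h₁ := Finset.card_union_add_card_inter
      (Finset.univ.filter fun x => ∀ b ∈ A, G.Adj b x) (G.neighborFinset a)
    have h₂ := Finset.card_le_univ
      ((Finset.univ.filter fun x => ∀ b ∈ A, G.Adj b x) ∪ G.neighborFinset a)
    have h₃ := hd a
    rw [G.card_neighborFinset_eq_degree] at h₁
    rw [add_mul, add_mul]
    omega

/-- If every set of at most `m` vertices has a common neighbour, then every vertex is completely
joined to some clique on `m` vertices. -/
theorem exists_isNClique_forall_adj {V : Type*} [Fintype V] (G : SimpleGraph V) (m : ℕ)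
    (hG : ∀ A : Finset V, A.card ≤ m → ∃ x, ∀ a ∈ A, G.Adj a x) (v : V) :
    ∃ A : Finset V, G.IsNClique m A ∧ ∀ a ∈ A, G.Adj v a := by
  suffices H : ∀ j ≤ m, ∃ A : Finset V, G.IsNClique j A ∧ ∀ a ∈ A, G.Adj v a from H m le_rfl
  intro j
  induction j with
  | zero => exact fun _ => ⟨∅, by simp⟩
  | succ j ih =>
    intro hj
    obtain ⟨A, hA, hvA⟩ := ih (by omega)
    obtain ⟨x, hx⟩ := hG (insert v A)
      ((Finset.card_insert_le _ _).trans (by rw [hA.card_eq]; omega))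
    refine ⟨insert x A, hA.insert fun b hb => (hx b (Finset.mem_insert_of_mem hb)).symm, ?_⟩
    intro a ha
    rcases Finset.mem_insert.1 ha with rfl | ha
    · exact hx v (Finset.mem_insert_self _ _)
    · exact hvA a ha

/-- Observation 5.5 (minimum degree gives linkage in `K_k(G)`). -/
theorem min_degree_second_neighbours (k n : ℕ) (hk : 2 ≤ k) (G : SimpleGraph (Fin n))
    [DecidableRel G.Adj] (δ : ℝ) (hδ : (G.minDegree : ℝ) = δ * n)
    (h : ((k : ℝ) - 2) / ((k : ℝ) - 1) * n + 1 < δ * n) :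
    ∀ v : Fin n, ∃ K ∈ G.cliqueSet k, v ∉ K ∧ ∃ e ∈ G.cliqueSet k, v ∈ e ∧
      (e ∩ K).card = k - 1 := by
  obtain ⟨p, rfl⟩ := Nat.exists_eq_add_of_le' hk
  have hdeg : p * n + (p + 1) < (p + 1) * G.minDegree := by
    rw [← hδ] at h
    push_cast at h
    have hp : (0 : ℝ) < (p : ℝ) + 1 := by positivity
    have e₁ : (p : ℝ) + 2 - 2 = p := by ring
    have e₂ : (p : ℝ) + 2 - 1 = p + 1 := by ring
    rw [e₁, e₂] at h
    have h' := mul_lt_mul_of_pos_left h hp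
    have e₃ : ((p : ℝ) + 1) * (p / (p + 1) * n + 1) = p * n + (p + 1) := by
      field_simp
    rw [e₃] at h'
    exact_mod_cast h'
  intro v
  have hdn : G.minDegree ≤ n := by
    have := (G.minDegree_le_degree v).trans (G.degree_lt_card_verts v).le
    simpa using this
  have hcommon : ∀ A : Finset (Fin n), A.card ≤ p + 1 →
      1 < (Finset.univ.filter fun x => ∀ a ∈ A, G.Adj a x).card := by
    intro A hA
    have hc : n + A.card * G.minDegree ≤
        (Finset.univ.filter fun x => ∀ a ∈ A, G.Adj a x).card + A.card * n := by
      have := card_add_mul_le_card_commonNeighbors G G.minDegree G.minDegree_le_degree A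
      rw [Fintype.card_fin] at this
      convert this
    obtain ⟨c, hc'⟩ := Nat.exists_eq_add_of_le hdn
    have hmul := Nat.mul_le_mul_right c hA
    have e₁ : A.card * n = A.card * G.minDegree + A.card * c := by rw [← mul_add, ← hc']
    have e₂ : (p + 1) * n = (p + 1) * G.minDegree + (p + 1) * c := by rw [← mul_add, ← hc']
    have e₃ : (p + 1) * n = p * n + n := by ring
    omega
  obtain ⟨A, hA, hvA⟩ := exists_isNClique_forall_adj G (p + 1) (fun A hA => by
    obtain ⟨x, hx⟩ := Finset.card_pos.1 (zero_lt_one.trans (hcommon A hA))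
    exact ⟨x, (Finset.mem_filter.1 hx).2⟩) v
  obtain ⟨w, hw, hwv⟩ := Finset.exists_mem_ne (hcommon A hA.card_eq.le) v
  have hwA := (Finset.mem_filter.1 hw).2
  have hv : v ∉ A := fun hv => G.irrefl (hvA v hv)
  have hv' : v ∉ insert w A := by simp [hv, hwv.symm]
  refine ⟨insert w A, hA.insert fun b hb => (hwA b hb).symm, hv', insert v A, hA.insert hvA,
    Finset.mem_insert_self _ _, ?_⟩
  rw [Finset.insert_inter_of_notMem hv', Finset.inter_eq_left.2 (Finset.subset_insert _ _),
    hA.card_eq]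
  rfl

end Paper
end

section
/- For every rational χ > 1 and every μ > 0 there exists n₀ such that the following holds for every n ≥ n₀, with k = ⌈χ⌉. Suppose G is a graph on n vertices whose degree sequence is (χ,μ)-strong. Then K_k(G) is linked; moreover, if k ≥ 3, then K_k(G) has exactly one loose component. -/
open scoped Classical

namespace Paper

/-- The vertices adjacent to every vertex of `s`. -/
noncomputable def commonNbrs {V : Type} [Fintype V] (G : SimpleGraph V) (s : Finset V) : Finset V :=
  Finset.univ.filter fun w => ∀ u ∈ s, G.Adj u w

section CommonNbrs

variable {V : Type} [Fintype V] {G : SimpleGraph V}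

lemma mem_commonNbrs {s : Finset V} {w : V} : w ∈ commonNbrs G s ↔ ∀ u ∈ s, G.Adj u w := by
  simp [commonNbrs]

lemma card_commonNbrs_singleton (v : V) : (commonNbrs G {v}).card = ndeg G v := by
  rw [ndeg, ← Set.ncard_coe_finset]
  congr 1
  ext w
  simp [mem_commonNbrs]

lemma card_commonNbrs_insert (x : V) (s : Finset V) :
    ((commonNbrs G s).card : ℝ) + ndeg G x - Fintype.card V ≤
      (commonNbrs G (insert x s)).card := by
  have h : commonNbrs G (insert x s) = commonNbrs G {x} ∩ commonNbrs G s := by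
    ext w
    simp [mem_commonNbrs]
  have h1 := Finset.card_union_add_card_inter (commonNbrs G {x}) (commonNbrs G s)
  have h2 := Finset.card_le_univ (commonNbrs G {x} ∪ commonNbrs G s)
  rw [← h, card_commonNbrs_singleton] at h1
  have h3 : (commonNbrs G s).card + ndeg G x ≤
      (commonNbrs G (insert x s)).card + Fintype.card V := by omega
  have h4 : ((commonNbrs G s).card : ℝ) + ndeg G x ≤
      (commonNbrs G (insert x s)).card + Fintype.card V := by exact_mod_cast h3
  linarith

lemma isNClique_insert {m : ℕ} {s : Finset V} {x : V} (hs : G.IsNClique m s)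
    (hx : x ∈ commonNbrs G s) : G.IsNClique (m + 1) (insert x s) :=
  hs.insert fun u hu => (mem_commonNbrs.1 hx u hu).symm

lemma notMem_of_mem_commonNbrs {s : Finset V} {x : V} (hx : x ∈ commonNbrs G s) : x ∉ s :=
  fun h => G.loopless.irrefl x (mem_commonNbrs.1 hx x h)

end CommonNbrs

section BigVertices

variable {V : Type} [Fintype V] {G : SimpleGraph V} {β η : ℝ}

/-- The vertices of degree at least `|V| - β + η`. -/
noncomputable def bigVertices {V : Type} [Fintype V] (G : SimpleGraph V) (β η : ℝ) : Finset V :=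
  Finset.univ.filter fun v => (Fintype.card V : ℝ) - β + η ≤ ndeg G v

lemma mem_bigVertices {v : V} :
    v ∈ bigVertices G β η ↔ (Fintype.card V : ℝ) - β + η ≤ ndeg G v := by
  simp [bigVertices]

lemma exists_mem_bigVertices (hfew : (((bigVertices G β η)ᶜ).card : ℝ) ≤ β) {A : Finset V}
    (hA : β < A.card) : ∃ x ∈ A, x ∈ bigVertices G β η := by
  by_contra! h
  have h1 : A ⊆ (bigVertices G β η)ᶜ := fun x hx => Finset.mem_compl.2 (h x hx)
  have h2 : (A.card : ℝ) ≤ ((bigVertices G β η)ᶜ).card := by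
    exact_mod_cast Finset.card_le_card h1
  linarith

lemma le_card_commonNbrs_of_subset_bigVertices (hη : 0 ≤ η) {t : Finset V}
    (ht : t ⊆ bigVertices G β η) :
    (Fintype.card V : ℝ) - t.card * β ≤ (commonNbrs G t).card := by
  induction t using Finset.induction_on with
  | empty => simp [commonNbrs]
  | insert x t hx ih =>
    have h1 := ih fun y hy => ht (Finset.mem_insert_of_mem hy)
    have h2 := mem_bigVertices.1 (ht (Finset.mem_insert_self x t))
    have h3 := card_commonNbrs_insert (G := G) x t
    rw [Finset.card_insert_of_notMem hx]
    push_cast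
    linarith

/-- A clique with many common neighbours extends by `r` big vertices. -/
lemma exists_isNClique_extension (hβ : 0 ≤ β) (hη : 0 < η)
    (hfew : (((bigVertices G β η)ᶜ).card : ℝ) ≤ β) (r : ℕ) :
    ∀ {m : ℕ} {s : Finset V}, G.IsNClique m s → r * β + η ≤ (commonNbrs G s).card →
      ∃ t ⊆ bigVertices G β η, t.card = r ∧ Disjoint t s ∧ G.IsNClique (m + r) (t ∪ s) ∧
        η ≤ (commonNbrs G (t ∪ s)).card := by
  induction r with
  | zero =>
    intro m s hs hc
    exact ⟨∅, by simp, by simp, by simp, by simpa using hs, by simpa using hc⟩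
  | succ r ih =>
    intro m s hs hc
    push_cast at hc
    obtain ⟨x, hxs, hxB⟩ := exists_mem_bigVertices hfew (A := commonNbrs G s) (by
      have : 0 ≤ (r : ℝ) * β := by positivity
      linarith)
    have h1 := mem_bigVertices.1 hxB
    have h2 := card_commonNbrs_insert (G := G) x s
    obtain ⟨t, htB, htc, hdis, hcl, hcom⟩ := ih (isNClique_insert hs hxs) (by linarith)
    rw [Finset.disjoint_insert_right] at hdis
    have heq : insert x t ∪ s = t ∪ insert x s := by
      rw [Finset.insert_union, Finset.union_insert]
    refine ⟨insert x t, Finset.insert_subset hxB htB, ?_, ?_, ?_, ?_⟩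
    · rw [Finset.card_insert_of_notMem hdis.1, htc]
    · exact Finset.disjoint_insert_left.2 ⟨notMem_of_mem_commonNbrs hxs, hdis.2⟩
    · rw [heq]
      convert hcl using 1
      ring
    · rwa [heq]

lemma linked_cliqueSet (hβ : 0 ≤ β) (hη : 1 < η)
    (hfew : (((bigVertices G β η)ᶜ).card : ℝ) ≤ β) {r : ℕ}
    (hdeg : ∀ v, r * β + η ≤ ndeg G v) : Linked (r + 2) (G.cliqueSet (r + 2)) := by
  intro v
  have hη0 : 0 < η := by linarith
  obtain ⟨t, htB, htc, hdis, hcl, hcom⟩ := exists_isNClique_extension hβ hη0 hfew r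
    (m := 1) (s := {v}) (by simp) (by rw [card_commonNbrs_singleton]; exact hdeg v)
  rw [Finset.disjoint_singleton_right] at hdis
  have hpos : 0 < (commonNbrs G (t ∪ {v})).card := by
    exact_mod_cast hη0.trans_le hcom
  obtain ⟨u, hu⟩ := Finset.card_pos.1 hpos
  have hu' := mem_commonNbrs.1 hu
  have hvu : G.Adj v u := hu' v (by simp)
  have hut : u ∈ commonNbrs G t :=
    mem_commonNbrs.2 fun w hw => hu' w (Finset.mem_union_left _ hw)
  have htcl : G.IsNClique r t :=
    ⟨hcl.isClique.subset (by simp), htc⟩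
  have hucl := isNClique_insert htcl hut
  have hbig : 1 < (commonNbrs G (insert u t)).card := by
    have h1 := le_card_commonNbrs_of_subset_bigVertices hη0.le htB
    have h2 := card_commonNbrs_insert (G := G) u t
    have h3 := hdeg u
    rw [htc] at h1
    have : (1 : ℝ) < (commonNbrs G (insert u t)).card := by linarith
    exact_mod_cast this
  have hvc : v ∈ commonNbrs G (insert u t) := by
    refine mem_commonNbrs.2 fun w hw => ?_
    rcases Finset.mem_insert.1 hw with rfl | hw
    · exact hvu.symm
    · refine hcl.isClique (by simp [hw]) (by simp) ?_
      rintro rfl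
      exact hdis hw
  obtain ⟨w, hw, hwv⟩ := Finset.exists_mem_ne hbig v
  have hv' := notMem_of_mem_commonNbrs hvc
  have hw' := notMem_of_mem_commonNbrs hw
  refine ⟨insert w (insert u t), isNClique_insert hucl hw, ?_,
    insert v (insert u t), isNClique_insert hucl hvc, Finset.mem_insert_self _ _, ?_⟩
  · rw [Finset.mem_insert]
    rintro (h | h)
    · exact hwv h.symm
    · exact hv' h
  · have hvw : v ∉ insert w (insert u t) := by
      rw [Finset.mem_insert]
      rintro (h | h)
      · exact hwv h.symm
      · exact hv' h
    rw [Finset.insert_inter_of_notMem hvw, Finset.inter_eq_left.2 (Finset.subset_insert _ _),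
      hucl.card_eq]
    rfl

/-- Every edge with a big endpoint lies in a clique of size `r + 3`. -/
lemma exists_mem_cliqueSet_of_adj (hβ : 0 ≤ β) (hη : 0 < η)
    (hfew : (((bigVertices G β η)ᶜ).card : ℝ) ≤ β) {r : ℕ}
    (hdeg : ∀ v, (r + 1 : ℕ) * β + η ≤ ndeg G v) {x y : V} (hx : x ∈ bigVertices G β η)
    (hxy : G.Adj x y) : ∃ e ∈ G.cliqueSet (r + 3), x ∈ e ∧ y ∈ e := by
  have h1 := card_commonNbrs_insert (G := G) x {y}
  have h2 := hdeg y
  have h3 := mem_bigVertices.1 hx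
  rw [card_commonNbrs_singleton] at h1
  push_cast at h2
  have hxc : x ∈ commonNbrs G {y} := by simpa [mem_commonNbrs] using hxy.symm
  obtain ⟨t, -, -, -, hcl, hcom⟩ := exists_isNClique_extension hβ hη hfew r
    (isNClique_insert (G := G) (m := 1) (s := {y}) (by simp) hxc) (by linarith)
  have hpos : 0 < (commonNbrs G (t ∪ insert x {y})).card := by
    exact_mod_cast hη.trans_le hcom
  obtain ⟨u, hu⟩ := Finset.card_pos.1 hpos
  refine ⟨_, ?_, Finset.mem_insert_of_mem (a := x) (b := u) (s := t ∪ insert x {y}) (by simp),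
    by simp⟩
  have := isNClique_insert hcl hu
  rw [SimpleGraph.mem_cliqueSet_iff]
  convert this using 1
  ring

end BigVertices

lemma looseCount_eq_one {V : Type} [Fintype V] [Nonempty V] {k : ℕ} {E : Set (Finset V)}
    (hne : ∀ e ∈ E, e.Nonempty) (hcov : ∀ v, ∃ e ∈ E, v ∈ e)
    (hconn : ∀ u v, Relation.ReflTransGen (fun a b => ∃ e ∈ E, a ∈ e ∧ b ∈ e) u v) :
    looseCount k E = 1 := by
  have hshare : ∀ (e f : E) (v : V), v ∈ (e : Finset V) → v ∈ (f : Finset V) →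
      (LGraph k E).Reachable ((TGraph k E).connectedComponentMk e)
        ((TGraph k E).connectedComponentMk f) := by
    intro e f v he hf
    by_cases h : (TGraph k E).connectedComponentMk e = (TGraph k E).connectedComponentMk f
    · rw [h]
    · refine SimpleGraph.Adj.reachable ?_
      rw [LGraph, SimpleGraph.fromRel_adj]
      exact ⟨h, Or.inl ⟨v, ⟨e, rfl, he⟩, ⟨f, rfl, hf⟩⟩⟩
  have hall : ∀ (e f : E), (LGraph k E).Reachable ((TGraph k E).connectedComponentMk e)
      ((TGraph k E).connectedComponentMk f) := by
    intro e f
    obtain ⟨u, hu⟩ := hne e e.2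
    obtain ⟨v, hv⟩ := hne f f.2
    have key : ∀ g : E, v ∈ (g : Finset V) →
        (LGraph k E).Reachable ((TGraph k E).connectedComponentMk e)
          ((TGraph k E).connectedComponentMk g) := by
      clear hv f
      induction hconn u v with
      | refl => exact fun g hg => hshare e g u hu hg
      | tail _ hbc ih =>
        obtain ⟨h, hE, hb, hc⟩ := hbc
        exact fun g hg => (ih ⟨h, hE⟩ hb).trans (hshare ⟨h, hE⟩ g _ hc hg)
    exact key f hv
  obtain ⟨e, he, -⟩ := hcov (Classical.arbitrary V)
  rw [looseCount, Nat.card_eq_one_iff_unique]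
  refine ⟨⟨fun c d => ?_⟩, ⟨(LGraph k E).connectedComponentMk
    ((TGraph k E).connectedComponentMk ⟨e, he⟩)⟩⟩
  induction c using SimpleGraph.ConnectedComponent.ind with | _ c => ?_
  induction d using SimpleGraph.ConnectedComponent.ind with | _ d => ?_
  induction c using SimpleGraph.ConnectedComponent.ind with | _ c => ?_
  induction d using SimpleGraph.ConnectedComponent.ind with | _ d => ?_
  exact SimpleGraph.ConnectedComponent.sound (hall c d)

lemma looseCount_cliqueSet {V : Type} [Fintype V] [Nonempty V] {G : SimpleGraph V} {β η : ℝ}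
    (hβ : 0 ≤ β) (hη : 0 < η) (hcard : 2 * β ≤ Fintype.card V)
    (hfew : (((bigVertices G β η)ᶜ).card : ℝ) ≤ β) {r : ℕ}
    (hdeg : ∀ v, (r + 1 : ℕ) * β + η ≤ ndeg G v) :
    looseCount (r + 3) (G.cliqueSet (r + 3)) = 1 := by
  have hedge := fun x y => exists_mem_cliqueSet_of_adj (x := x) (y := y) hβ hη hfew hdeg
  have hnbr : ∀ v, ∃ x ∈ bigVertices G β η, G.Adj x v := by
    intro v
    obtain ⟨x, hxv, hx⟩ := exists_mem_bigVertices hfew (A := commonNbrs G {v}) (by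
      rw [card_commonNbrs_singleton]
      have h1 := hdeg v
      have : 0 ≤ (r : ℝ) * β := by positivity
      push_cast at h1
      linarith)
    exact ⟨x, hx, ((mem_commonNbrs.1 hxv) v (by simp)).symm⟩
  refine looseCount_eq_one ?_ ?_ ?_
  · intro e he
    rw [← Finset.card_pos, (SimpleGraph.mem_cliqueSet_iff.1 he).card_eq]
    omega
  · intro v
    obtain ⟨x, hx, hxv⟩ := hnbr v
    obtain ⟨e, he, -, hv⟩ := hedge x v hx hxv
    exact ⟨e, he, hv⟩
  · intro u v
    obtain ⟨x, hx, hxu⟩ := hnbr u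
    obtain ⟨y, hy, hyv⟩ := hnbr v
    have hpos : (0 : ℝ) < (commonNbrs G (insert x {y})).card := by
      have h1 := card_commonNbrs_insert (G := G) x {y}
      rw [card_commonNbrs_singleton] at h1
      have h2 := mem_bigVertices.1 hx
      have h3 := mem_bigVertices.1 hy
      linarith
    obtain ⟨z, hz⟩ := Finset.card_pos.1 (by exact_mod_cast hpos)
    rw [mem_commonNbrs] at hz
    obtain ⟨e₁, he₁, hxe₁, hue₁⟩ := hedge x u hx hxu
    obtain ⟨e₂, he₂, hxe₂, hze₂⟩ := hedge x z hx (hz x (by simp))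
    obtain ⟨e₃, he₃, hye₃, hze₃⟩ := hedge y z hy (hz y (by simp))
    obtain ⟨e₄, he₄, hye₄, hve₄⟩ := hedge y v hy hyv
    exact (((Relation.ReflTransGen.single ⟨e₁, he₁, hue₁, hxe₁⟩).tail
      ⟨e₂, he₂, hxe₂, hze₂⟩).tail ⟨e₃, he₃, hze₃, hye₃⟩).tail ⟨e₄, he₄, hye₄, hve₄⟩

/-- A strong degree sequence bounds the minimum degree and the number of vertices of
small degree. -/
lemma DegSeqStrong.degree_bounds {V : Type} [Fintype V] {G : SimpleGraph V} {χ μ : ℝ} {r : ℕ}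
    (hχ : 1 < χ) (hr : r + 1 ≤ χ) (hr' : χ ≤ r + 2) (hceil : ⌈χ⌉₊ = r + 2)
    (hcard : χ ≤ Fintype.card V) (hμ : 2 ≤ μ * Fintype.card V) (h : DegSeqStrong G χ μ) :
    (∀ v, r * (Fintype.card V / χ) + μ * Fintype.card V / 2 ≤ ndeg G v) ∧
      (((bigVertices G (Fintype.card V / χ) (μ * Fintype.card V / 2))ᶜ).card : ℝ) ≤
        Fintype.card V / χ := by
  have hχ0 : 0 < χ := by linarith
  rw [DegSeqStrong] at h
  set n := Fintype.card V with hn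
  obtain ⟨e, hmono, hd⟩ := h
  have hlin : 1 - 1 / χ - alphaOf χ = r * (1 / χ) := by
    rw [alphaOf, hceil]
    field_simp
    push_cast
    ring
  have hslope : χ * alphaOf χ = χ - (r + 1) := by
    rw [alphaOf, hceil]
    field_simp
    push_cast
    ring
  rw [hlin, hslope] at hd
  have hβ1 : 1 ≤ (n : ℝ) / χ := (one_le_div hχ0).2 hcard
  have hβχ : (n : ℝ) / χ * χ = n := div_mul_cancel₀ _ hχ0.ne'
  have hβdef : (n : ℝ) / χ = 1 / χ * n := by ring
  have hn0 : 0 < n := by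
    have : (0 : ℝ) < n := hχ0.trans_le hcard
    exact_mod_cast this
  constructor
  · intro v
    have h0 := hd ⟨0, hn0⟩ (by simpa using hβ1)
    have h1 := hmono ⟨0, hn0⟩ (e.symm v) (by simp [Fin.le_def])
    rw [Equiv.apply_symm_apply] at h1
    have h2 : (ndeg G (e ⟨0, hn0⟩) : ℝ) ≤ ndeg G v := by exact_mod_cast h1
    simp only [Nat.cast_zero, zero_add, mul_one] at h0
    rw [hβdef, ← mul_assoc]
    linarith
  · have hm1 : 1 ≤ ⌊(n : ℝ) / χ⌋₊ := (Nat.one_le_floor_iff _).2 hβ1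
    obtain ⟨m, hm⟩ := Nat.exists_eq_add_of_le' hm1
    have hfl : (m : ℝ) + 1 ≤ n / χ := by
      have := Nat.floor_le (zero_le_one.trans hβ1)
      rw [hm] at this
      exact_mod_cast this
    have hlt : (n : ℝ) / χ < m + 2 := by
      have := Nat.lt_floor_add_one ((n : ℝ) / χ)
      rw [hm] at this
      push_cast at this
      linarith
    have hmn : m < n := by
      have h1 : (n : ℝ) / χ ≤ n := div_le_self (by positivity) hχ.le
      have h2 : (m : ℝ) < n := by linarith
      exact_mod_cast h2
    have hbig : ∀ i : Fin n, m ≤ (i : ℕ) → e i ∈ bigVertices G (n / χ) (μ * n / 2) := by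
      intro i hi
      rw [mem_bigVertices, ← hn]
      have h0 := hd ⟨m, hmn⟩ hfl
      have h1 := hmono ⟨m, hmn⟩ i hi
      have h2 : (ndeg G (e ⟨m, hmn⟩) : ℝ) ≤ ndeg G (e i) := by exact_mod_cast h1
      have h3 : (χ - (r + 1)) * ((n : ℝ) / χ - 1) ≤ (χ - (r + 1)) * (m + 1) :=
        mul_le_mul_of_nonneg_left (by linarith) (by linarith)
      simp only [mul_assoc (r : ℝ), ← hβdef] at h0
      nlinarith
    have hsub : (bigVertices G (n / χ) (μ * n / 2))ᶜ ⊆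
        (Finset.range m).image fun i => if hi : i < n then e ⟨i, hi⟩ else e ⟨0, hn0⟩ := by
      intro v hv
      rw [Finset.mem_compl] at hv
      rw [Finset.mem_image]
      refine ⟨(e.symm v : ℕ), ?_, by simp⟩
      rw [Finset.mem_range]
      by_contra! hle
      exact hv (by simpa using hbig (e.symm v) hle)
    have hle := (Finset.card_le_card hsub).trans Finset.card_image_le
    rw [Finset.card_range] at hle
    have : ((((bigVertices G (n / χ) (μ * n / 2))ᶜ).card : ℕ) : ℝ) ≤ m := by exact_mod_cast hle
    linarith

/-- Proposition 5.7 (strong degree sequences give linkage and one loose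
component). -/
theorem deg_seq_linked_edges (χ : ℚ) (μ : ℝ) (hχ : 1 < χ) (hμ : 0 < μ) :
    ∃ n₀ : ℕ, ∀ n : ℕ, n₀ ≤ n → ∀ G : SimpleGraph (Fin n),
      DegSeqStrong G (χ : ℝ) μ →
      Linked ⌈χ⌉₊ (G.cliqueSet ⌈χ⌉₊) ∧
      (3 ≤ ⌈χ⌉₊ → looseCount ⌈χ⌉₊ (G.cliqueSet ⌈χ⌉₊) = 1) := by
  obtain ⟨r, hr⟩ : ∃ r, ⌈χ⌉₊ = r + 2 :=
    Nat.exists_eq_add_of_le' (Nat.lt_ceil.2 (by exact_mod_cast hχ))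
  have hceil : ⌈(χ : ℝ)⌉₊ = r + 2 := by
    rw [← hr]
    refine le_antisymm (Nat.ceil_le.2 ?_) (Nat.ceil_le.2 ?_)
    · exact_mod_cast Nat.le_ceil χ
    · exact_mod_cast Nat.le_ceil (χ : ℝ)
  have hχ1 : (1 : ℝ) < χ := by exact_mod_cast hχ
  have hχ0 : (0 : ℝ) < χ := by linarith
  have hle : (χ : ℝ) ≤ r + 2 := by
    have := Nat.le_ceil (χ : ℝ)
    rw [hceil] at this
    exact_mod_cast this
  have hge : (r : ℝ) + 1 ≤ χ := by
    have := Nat.ceil_lt_add_one hχ0.le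
    rw [hceil] at this
    push_cast at this
    linarith
  obtain ⟨n₀, hn₀⟩ := exists_nat_ge (max (χ : ℝ) (3 / μ))
  refine ⟨n₀, fun n hn G hG => ?_⟩
  have hn' : max (χ : ℝ) (3 / μ) ≤ n := hn₀.trans (by exact_mod_cast hn)
  have hχn : (χ : ℝ) ≤ n := (le_max_left _ _).trans hn'
  have hμn : 3 ≤ μ * n := by
    have := (le_max_right _ _).trans hn'
    rwa [div_le_iff₀' hμ] at this
  obtain ⟨hdeg, hfew⟩ := hG.degree_bounds hχ1 hge hle hceil
    (by simpa using hχn) (by rw [Fintype.card_fin]; linarith)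
  have hβ : 0 ≤ (Fintype.card (Fin n) : ℝ) / χ := by positivity
  have hη : 1 < μ * (Fintype.card (Fin n) : ℝ) / 2 := by
    rw [Fintype.card_fin]
    linarith
  rw [hr]
  refine ⟨linked_cliqueSet hβ hη hfew hdeg, fun h3 => ?_⟩
  obtain ⟨q, rfl⟩ := Nat.exists_eq_add_of_le' (show 1 ≤ r by omega)
  have hn0 : (0 : ℝ) < n := hχ0.trans_le hχn
  have : Nonempty (Fin n) := ⟨⟨0, by exact_mod_cast hn0⟩⟩
  refine looseCount_cliqueSet hβ (by linarith) ?_ hfew hdeg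
  have h2χ : (2 : ℝ) ≤ χ := by
    push_cast at hge
    have : (0 : ℝ) ≤ q := by positivity
    linarith
  rw [Fintype.card_fin, ← mul_div_assoc, div_le_iff₀ hχ0]
  nlinarith

end Paper
end

section
/- Let F be a graph on f ≥ 2 vertices and let R be a graph with a perfect fractional F-tiling. Then R contains a spanning subgraph R′ with maximum degree Δ(R′) ≤ f⁴ that is a homomorphism F-cover of R: R′ is a union of homomorphic images of F in R, and every vertex of R belongs to the vertex set of one of these homomorphic images. -/
open scoped Classical

namespace Paper

/-- An underdetermined homogeneous linear system has a nonzero solution supported on `S`. -/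
theorem exists_ne_zero_supported_sum_eq_zero {T V : Type*} [Fintype T]
    (a : T → V → ℝ) (S : Finset T) (A : Finset V) (h : A.card < S.card) :
    ∃ d : T → ℝ, d ≠ 0 ∧ (∀ t ∉ S, d t = 0) ∧ ∀ v ∈ A, ∑ t, a t v * d t = 0 := by
  let L : (S → ℝ) →ₗ[ℝ] (A → ℝ) :=
    LinearMap.pi fun v => ∑ t : S, a t v • LinearMap.proj t
  have hL : ¬ Function.Injective L := fun hi => by
    have := LinearMap.finrank_le_finrank_of_injective hi
    simp at this
    omega
  obtain ⟨e, he, hne⟩ : ∃ e, L e = 0 ∧ e ≠ 0 := by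
    by_contra! hc
    exact hL ((injective_iff_map_eq_zero L).2 hc)
  refine ⟨fun t => if ht : t ∈ S then e ⟨t, ht⟩ else 0, ?_, fun t ht => by simp [ht], ?_⟩
  · intro h0
    apply hne
    ext t
    simpa using congrFun h0 t
  · intro v hv
    have h1 := congrFun he ⟨v, hv⟩
    simp only [L, LinearMap.pi_apply, LinearMap.sum_apply, LinearMap.smul_apply,
      LinearMap.proj_apply, smul_eq_mul, Pi.zero_apply] at h1
    refine Eq.trans ?_ h1
    rw [← Finset.sum_subset (Finset.subset_univ S) (by intro t _ ht; simp [ht]),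
      ← Finset.sum_coe_sort]
    simp

/-- Moving from `x` in direction `d`, stop when a first coordinate becomes an integer. -/
theorem exists_step_to_integer {T : Type*} [Fintype T] (x d : T → ℝ) (hd : d ≠ 0) :
    ∃ s : ℝ, (∀ t, (⌊x t⌋ : ℝ) ≤ x t + s * d t ∧ x t + s * d t ≤ ⌈x t⌉) ∧
      ∃ t, d t ≠ 0 ∧ Int.fract (x t + s * d t) = 0 := by
  let g : T → ℝ := fun t => if 0 < d t then (⌈x t⌉ - x t) / d t else (⌊x t⌋ - x t) / d t
  obtain ⟨t₀, ht₀⟩ := Function.ne_iff.1 hd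
  obtain ⟨m, hm, hmin⟩ := Finset.exists_min_image (Finset.univ.filter fun t => d t ≠ 0) g
    ⟨t₀, by simpa using ht₀⟩
  simp only [Finset.mem_filter, Finset.mem_univ, true_and] at hm hmin
  have hg : ∀ t, 0 ≤ g t := by
    intro t
    simp only [g]
    split_ifs with h
    · exact div_nonneg (sub_nonneg.2 (Int.le_ceil _)) h.le
    · exact div_nonneg_of_nonpos (sub_nonpos.2 (Int.floor_le _)) (not_lt.1 h)
  refine ⟨g m, fun t => ?_, m, hm, ?_⟩
  · have h1 := Int.floor_le (x t)
    have h2 := Int.le_ceil (x t)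
    rcases lt_trichotomy (d t) 0 with h | h | h
    · have h3 := hmin t h.ne
      have h4 : g t * d t = ⌊x t⌋ - x t := by simp [g, h.not_gt, h.ne]
      constructor <;> nlinarith [hg m]
    · simp [h, h1, h2]
    · have h3 := hmin t h.ne'
      have h4 : g t * d t = ⌈x t⌉ - x t := by simp [g, h, h.ne']
      constructor <;> nlinarith [hg m]
  · by_cases h : 0 < d m
    · simp [g, h, hm]
    · simp [g, h, hm]

/-- If the mass of the non-integral coordinates is at most `K`, any rounding of them changes a
nonnegative linear form by less than `K`. -/
theorem abs_sum_rounding_lt {T : Type*} [Fintype T] (a x : T → ℝ) (y : T → ℤ) {K : ℝ}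
    (hK : 0 < K) (ha : ∀ t, 0 ≤ a t) (hy : ∀ t, ⌊x t⌋ ≤ y t ∧ y t ≤ ⌈x t⌉)
    (h : ∑ t with Int.fract (x t) ≠ 0, a t ≤ K) :
    |∑ t, a t * (y t - x t)| < K := by
  have hlt : ∀ t, |(y t : ℝ) - x t| < 1 := by
    intro t
    have h1 : (⌊x t⌋ : ℝ) ≤ y t := by exact_mod_cast (hy t).1
    have h2 : (y t : ℝ) ≤ ⌈x t⌉ := by exact_mod_cast (hy t).2
    rw [abs_lt]
    constructor <;> linarith [Int.lt_floor_add_one (x t), Int.ceil_lt_add_one (x t)]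
  have hint : ∀ t, Int.fract (x t) = 0 → (y t : ℝ) - x t = 0 := by
    intro t ht
    obtain ⟨n, hn⟩ := Int.fract_eq_zero_iff.1 ht
    have := hy t
    rw [← hn, Int.floor_intCast, Int.ceil_intCast] at this
    rw [← hn, le_antisymm this.2 this.1, sub_self]
  have hS : ∑ t, a t * (y t - x t) =
      ∑ t with Int.fract (x t) ≠ 0, a t * (y t - x t) := by
    symm
    apply Finset.sum_subset (Finset.subset_univ _)
    intro t _ ht
    rw [hint t (by simpa using ht), mul_zero]
  rw [hS]
  refine (Finset.abs_sum_le_sum_abs _ _).trans_lt ?_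
  by_cases hpos : ∃ t, Int.fract (x t) ≠ 0 ∧ 0 < a t
  · obtain ⟨t, ht, hat⟩ := hpos
    refine lt_of_lt_of_le (Finset.sum_lt_sum (fun i _ => ?_) ⟨t, by simpa using ht, ?_⟩) h
    · rw [abs_mul, abs_of_nonneg (ha i)]
      exact mul_le_of_le_one_right (ha i) (hlt i).le
    · rw [abs_mul, abs_of_nonneg (ha t)]
      exact mul_lt_of_lt_one_right hat (hlt t)
  · push Not at hpos
    rw [Finset.sum_eq_zero]
    · exact hK
    · intro t ht
      rw [le_antisymm (hpos t (by simpa using ht)) (ha t)]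
      simp

/-- Beck–Fiala rounding: if each column of a nonnegative matrix has sum at most `K`, every real
vector can be rounded so that each linear form changes by less than `K`. -/
theorem exists_rounding {T V : Type*} [Fintype T] [Fintype V] (a : T → V → ℝ) {K : ℝ}
    (hK : 0 < K) (ha : ∀ t v, 0 ≤ a t v) (hcol : ∀ t, ∑ v, a t v ≤ K) (x : T → ℝ) :
    ∃ y : T → ℤ, (∀ t, ⌊x t⌋ ≤ y t ∧ y t ≤ ⌈x t⌉) ∧
      ∀ v, |∑ t, a t v * (y t - x t)| < K := by
  classical
  induction hn : (Finset.univ.filter fun t => Int.fract (x t) ≠ 0).card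
    using Nat.strong_induction_on generalizing x with
  | _ n ih =>
    set S := Finset.univ.filter fun t => Int.fract (x t) ≠ 0 with hS
    by_cases hempty : S = ∅
    · have hr : ∀ t, ⌊x t⌋ ≤ ⌊x t⌋ ∧ ⌊x t⌋ ≤ ⌈x t⌉ := fun t => ⟨le_rfl, Int.floor_le_ceil _⟩
      refine ⟨fun t => ⌊x t⌋, hr, fun v => abs_sum_rounding_lt _ x _ hK (ha · v) hr ?_⟩
      rw [← hS, hempty]
      simpa using hK.le
    set A := Finset.univ.filter fun v => K < ∑ t ∈ S, a t v with hA
    have hcard : A.card < S.card := by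
      by_contra! hle
      have hSpos : 0 < S.card := Finset.card_pos.2 (Finset.nonempty_iff_ne_empty.2 hempty)
      have hApos : A.Nonempty := Finset.card_pos.1 (hSpos.trans_le hle)
      have h1 : ∑ _v ∈ A, K < ∑ v ∈ A, ∑ t ∈ S, a t v :=
        Finset.sum_lt_sum_of_nonempty hApos fun v hv => by simpa [hA] using hv
      have h2 : ∑ v ∈ A, ∑ t ∈ S, a t v ≤ ∑ _t ∈ S, K := by
        rw [Finset.sum_comm]
        exact Finset.sum_le_sum fun t _ => (Finset.sum_le_sum_of_subset_of_nonneg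
          (Finset.subset_univ A) fun v _ _ => ha t v).trans (hcol t)
      simp only [Finset.sum_const, nsmul_eq_mul] at h1 h2
      have h3 : (S.card : ℝ) ≤ A.card := by exact_mod_cast hle
      nlinarith
    obtain ⟨d, hd, hdS, hdA⟩ := exists_ne_zero_supported_sum_eq_zero a S A hcard
    obtain ⟨s, hs, m, hdm, hm⟩ := exists_step_to_integer x d hd
    have hlt : (Finset.univ.filter fun t => Int.fract (x t + s * d t) ≠ 0).card < n := by
      rw [← hn]
      apply Finset.card_lt_card
      refine (Finset.ssubset_iff_of_subset fun t ht => ?_).2 ⟨m, ?_, by simp [hm]⟩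
      · by_contra htS
        simp only [hdS t htS, mul_zero, add_zero, Finset.mem_filter] at ht
        exact htS (by simpa [hS] using ht)
      · by_contra hmS
        exact hdm (hdS m hmS)
    obtain ⟨y, hy, hyv⟩ := ih _ hlt (fun t => x t + s * d t) rfl
    have hr : ∀ t, ⌊x t⌋ ≤ y t ∧ y t ≤ ⌈x t⌉ := fun t =>
      ⟨(Int.le_floor.2 (hs t).1).trans (hy t).1, (hy t).2.trans (Int.ceil_le.2 (hs t).2)⟩
    refine ⟨y, hr, fun v => ?_⟩
    by_cases hv : v ∈ A
    · have h1 : ∑ t, a t v * (y t - x t) = ∑ t, a t v * (y t - (x t + s * d t)) := by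
        have h2 : ∑ t, a t v * (y t - x t) =
            ∑ t, a t v * (y t - (x t + s * d t)) + s * ∑ t, a t v * d t := by
          rw [Finset.mul_sum, ← Finset.sum_add_distrib]
          exact Finset.sum_congr rfl fun t _ => by ring
        rw [h2, hdA v hv, mul_zero, add_zero]
      rw [h1]
      exact hyv v
    · exact abs_sum_rounding_lt _ x y hK (ha · v) hr (by simpa [hA] using hv)

/-- The fibres of a map partition its domain. -/
theorem sum_ncard_fiber {α W : Type*} [Fintype α] [Fintype W] (g : α → W) :
    ∑ v, {u | g u = v}.ncard = Fintype.card α := by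
  classical
  rw [← Finset.card_univ, Finset.card_eq_sum_card_fiberwise (f := g) (t := Finset.univ) (by simp)]
  refine Finset.sum_congr rfl fun v _ => ?_
  rw [← Set.ncard_coe_finset]
  simp

/-- A perfect fractional tiling saturates every vertex. -/
theorem IsFracTiling.sum_eq_one {α W : Type} [Fintype α] [Fintype W] {F : SimpleGraph α}
    {R : SimpleGraph W} [Fintype (F →g R)] {ω : (F →g R) → ℝ} (h : IsFracTiling F R ω)
    (hw : fracWeight F R ω = Fintype.card W) (v : W) :
    ∑ θ, ω θ * ({u | θ u = v}.ncard : ℝ) = 1 := by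
  have hle : ∀ v ∈ Finset.univ, ∑ θ : F →g R, ω θ * ({u | θ u = v}.ncard : ℝ) ≤ 1 := fun v _ => by
    rw [← finsum_eq_sum_of_fintype]
    exact h.2 v
  refine (Finset.sum_eq_sum_iff_of_le hle).1 ?_ v (Finset.mem_univ v)
  rw [Finset.sum_comm]
  simp_rw [← Finset.mul_sum, ← Nat.cast_sum, sum_ncard_fiber, ← Finset.sum_mul]
  rw [fracWeight, finsum_eq_sum_of_fintype, mul_comm] at hw
  simpa using hw

/-- If few members of a family of homomorphisms cover `v`, then `v` has few neighbours in the
union of their images. -/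
theorem ndeg_le_of_cover {α W : Type} [Fintype α] [Fintype W] {F : SimpleGraph α}
    {R R' : SimpleGraph W} (Θ : Set (F →g R)) (v : W) (C : Finset (F →g R))
    (hC : ∀ θ ∈ Θ, ∀ x, θ x = v → θ ∈ C)
    (hadj : ∀ u, R'.Adj v u → ∃ θ ∈ Θ, ∃ x y, F.Adj x y ∧ θ x = v ∧ θ y = u) :
    ndeg R' v ≤ C.card * Fintype.card α := by
  classical
  let B : Finset W := C.biUnion fun θ => Finset.univ.image θ
  have hsub : R'.neighborSet v ⊆ B := by
    intro u hu
    obtain ⟨θ, hθ, x, y, -, hx, hy⟩ := hadj u hu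
    simp only [B, Finset.coe_biUnion, Set.mem_iUnion]
    exact ⟨θ, hC θ hθ x hx, by simp [← hy]⟩
  refine (Set.ncard_le_ncard hsub B.finite_toSet).trans ?_
  rw [Set.ncard_coe_finset]
  exact Finset.card_biUnion_le_card_mul _ _ _ fun θ _ => Finset.card_image_le

/-- Lemma 7.2 (bounded degree homomorphism covers from perfect fractional
tilings). -/
theorem bounded_degree_cover_tight (f : ℕ) (hf : 2 ≤ f) {W : Type} [Fintype W]
    (F : SimpleGraph (Fin f)) (R : SimpleGraph W)
    (h : ∃ ω, IsFracTiling F R ω ∧ fracWeight F R ω = (Fintype.card W : ℝ)) :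
    ∃ R' : SimpleGraph W, R' ≤ R ∧ (∀ v, ndeg R' v ≤ f ^ 4) ∧
      ∃ Θ : Set (F →g R),
        (∀ u v, R'.Adj u v ↔ ∃ θ ∈ Θ, ∃ x y, F.Adj x y ∧ θ x = u ∧ θ y = v) ∧
        ∀ v : W, ∃ θ ∈ Θ, ∃ x, θ x = v := by
  classical
  obtain ⟨ω, hω, hw⟩ := h
  have : Finite (F →g R) := Finite.of_injective (fun θ : F →g R => (θ : Fin f → W))
    DFunLike.coe_injective
  let _ : Fintype (F →g R) := Fintype.ofFinite _
  have hf0 : (0 : ℝ) < f := by exact_mod_cast (by omega : 0 < f)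
  let a : (F →g R) → W → ℕ := fun θ v => {u | θ u = v}.ncard
  obtain ⟨y, hy, hyv⟩ := exists_rounding (fun θ v => (a θ v : ℝ)) hf0
    (fun _ _ => Nat.cast_nonneg _)
    (fun θ => by rw [← Nat.cast_sum, sum_ncard_fiber, Fintype.card_fin])
    (fun θ => f * ω θ)
  have hy0 : ∀ θ, 0 ≤ y θ := fun θ =>
    (Int.floor_nonneg.2 (mul_nonneg hf0.le (hω.1 θ).1)).trans (hy θ).1
  have hsum : ∀ v, 0 < ∑ θ, a θ v * y θ ∧ ∑ θ, a θ v * y θ < 2 * f := by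
    intro v
    have h1 := hyv v
    have h2 : ∑ θ, (a θ v : ℝ) * (y θ - f * ω θ) = ∑ θ, (a θ v : ℝ) * y θ - f := by
      conv_rhs => rw [← mul_one (f : ℝ), ← hω.sum_eq_one hw v, Finset.mul_sum,
        ← Finset.sum_sub_distrib]
      exact Finset.sum_congr rfl fun θ _ => by simp only [a]; ring
    rw [h2, abs_lt] at h1
    constructor
    · have : (0 : ℝ) < ∑ θ, (a θ v : ℝ) * y θ := by linarith
      exact_mod_cast this
    · have : ∑ θ, (a θ v : ℝ) * y θ < 2 * f := by linarith
      exact_mod_cast this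
  have ha : ∀ θ v x, θ x = v → 1 ≤ a θ v := fun θ v x hx =>
    Nat.one_le_iff_ne_zero.2 (Set.ncard_ne_zero_of_mem (a := x) hx)
  let Θ : Set (F →g R) := {θ | 0 < y θ}
  let R' : SimpleGraph W :=
    { Adj := fun u v => ∃ θ ∈ Θ, ∃ x y, F.Adj x y ∧ θ x = u ∧ θ y = v
      symm := ⟨fun u v ⟨θ, hθ, x, y, hxy, hx, hy⟩ => ⟨θ, hθ, y, x, hxy.symm, hy, hx⟩⟩
      loopless := ⟨fun u ⟨θ, _, x, y, hxy, hx, hy⟩ => (θ.map_adj hxy).ne (hx.trans hy.symm)⟩ }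
  refine ⟨R', ?_, fun v => ?_, Θ, fun u v => Iff.rfl, fun v => ?_⟩
  · rintro u v ⟨θ, -, x, y, hxy, rfl, rfl⟩
    exact θ.map_adj hxy
  · let C : Finset (F →g R) := Finset.univ.filter fun θ => 0 < y θ ∧ 1 ≤ a θ v
    have hC : C.card ≤ 2 * f := by
      have h1 : (C.card : ℤ) ≤ ∑ θ ∈ C, a θ v * y θ := by
        rw [Finset.card_eq_sum_ones, Nat.cast_sum]
        refine Finset.sum_le_sum fun θ hθ => ?_
        obtain ⟨h1, h2⟩ := (Finset.mem_filter.1 hθ).2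
        have h3 : (1 : ℤ) ≤ a θ v := by exact_mod_cast h2
        push_cast
        nlinarith
      have h2 : ∑ θ ∈ C, (a θ v : ℤ) * y θ ≤ ∑ θ, a θ v * y θ :=
        Finset.sum_le_sum_of_subset_of_nonneg (Finset.subset_univ C) fun θ _ _ =>
          mul_nonneg (Nat.cast_nonneg _) (hy0 θ)
      have := (hsum v).2
      omega
    have hdeg := ndeg_le_of_cover (R' := R') Θ v C
      (fun θ hθ x hx => by simpa [C] using ⟨hθ, ha θ v x hx⟩) (fun u hu => hu)
    rw [Fintype.card_fin] at hdeg
    calc ndeg R' v ≤ C.card * f := hdeg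
      _ ≤ 2 * f * f := Nat.mul_le_mul_right f hC
      _ ≤ f * f * (f * f) := by nlinarith [Nat.mul_le_mul hf hf, Nat.zero_le (f * f)]
      _ = f ^ 4 := by ring
  · obtain ⟨θ, -, hθ⟩ := Finset.exists_lt_of_sum_lt (f := fun _ => (0 : ℤ))
      (s := Finset.univ) (g := fun θ => a θ v * y θ) (by simpa using (hsum v).1)
    have hne : a θ v ≠ 0 := fun h0 => by simp [h0] at hθ
    obtain ⟨x, hx⟩ := Set.nonempty_of_ncard_ne_zero hne
    exact ⟨θ, pos_of_mul_pos_right hθ (Nat.cast_nonneg _), x, hx⟩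

end Paper
end

section
/- Let s, w ≥ 3 be integers and let A₁, …, A_s ⊆ {0, 1, …, w} be non-empty sets of integers with gcd(A_i) = 1 for all i ∈ [s]. Suppose that either (a) s ≥ 10·w·log w, or (b) s ≥ 10·w and A₁ = A₂ = … = A_s. Then there exists a multiset X = {x₁, …, x_s} with x_i ∈ A_i for each i such that the set of subset sums Σ(X) = { Σ_{i∈I} x_i : I ⊆ [s] } contains w+1 consecutive integers, i.e. an interval {z, z+1, …, z+w} for some integer z ≥ 0. -/
open scoped Classical

namespace Paper

/-- If every nonempty `B ⊆ F` whose elements all have weight at least `h` satisfies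
`|B| (h + 2) < C`, then the total weight of `F` is at most `C · H_{|F|} - 2|F|`. -/
theorem sum_add_two_le_mul_harmonic (m : ℕ → ℕ) (C : ℕ) (F : Finset ℕ)
    (hF : ∀ B ⊆ F, B.Nonempty → ∀ h, (∀ b ∈ B, h ≤ m b) → B.card * (h + 2) < C) :
    ∑ b ∈ F, ((m b : ℝ) + 2) ≤ C * (harmonic F.card : ℝ) := by
  induction hk : F.card generalizing F with
  | zero => simp [Finset.card_eq_zero.mp hk]
  | succ k ih =>
    have hne : F.Nonempty := Finset.card_pos.mp (by omega)
    obtain ⟨b, hb, hmin⟩ := F.exists_min_image m hne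
    have h1 := hF F subset_rfl hne (m b) hmin
    have h2 := ih (F.erase b)
      (fun B hB => hF B (hB.trans (Finset.erase_subset _ _))) (by
        rw [Finset.card_erase_of_mem hb, hk]; rfl)
    rw [← Finset.add_sum_erase F _ hb, harmonic_succ]
    have h3 : ((k + 1 : ℕ) : ℝ) * ((m b : ℝ) + 2) ≤ C := by
      rw [hk] at h1
      exact_mod_cast h1.le
    have h4 : (m b : ℝ) + 2 ≤ C * ((k + 1 : ℕ) : ℝ)⁻¹ := by
      rw [← div_eq_mul_inv, le_div_iff₀ (by positivity)]
      linarith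
    push_cast at h4 ⊢
    linarith

/-- A subset of `ℕ` of gcd one generates `ℤ`. -/
theorem one_mem_of_gcd_eq_one (K : AddSubgroup ℤ) (A : Finset ℕ) (hA : A.gcd id = 1)
    (hK : ∀ a ∈ A, (a : ℤ) ∈ K) : (1 : ℤ) ∈ K := by
  obtain ⟨d, rfl⟩ := Int.subgroup_cyclic K
  have h : d.natAbs ∣ A.gcd id := Finset.dvd_gcd fun a ha => by
    have := hK a ha
    rw [← AddSubgroup.zmultiples_eq_closure, Int.mem_zmultiples_iff] at this
    exact Int.natAbs_dvd_natAbs.mpr this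
  rw [hA, Nat.dvd_one] at h
  rw [← AddSubgroup.zmultiples_eq_closure, Int.mem_zmultiples_iff]
  exact Int.natAbs_dvd.mp (by simp [h])

/-- A nonempty finite subset of a quotient of `ℤ` that is stable under translation by a set of
gcd one is everything. -/
theorem eq_univ_of_translate_subset {Q : Type*} [AddCommGroup Q] [Fintype Q] (φ : ℤ →+ Q)
    (hφ : Function.Surjective φ) (A : Finset ℕ) (hA : A.gcd id = 1) (S : Finset Q)
    (hS : S.Nonempty) (hst : ∀ a ∈ A, ∀ x ∈ S, x + φ a ∈ S) : S = Finset.univ := by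
  let K : AddSubgroup ℤ :=
    { carrier := {z | ∀ x, x + φ z ∈ S ↔ x ∈ S}
      zero_mem' := by simp
      add_mem' := fun {a b} ha hb x => by
        rw [map_add, ← add_assoc, hb, ha]
      neg_mem' := fun {a} ha x => by
        rw [← ha, map_neg, neg_add_cancel_right] }
  have hK : ∀ a ∈ A, (a : ℤ) ∈ K := by
    intro a ha x
    refine ⟨fun hx => ?_, hst a ha x⟩
    have him : S.image (· + φ a) = S := Finset.eq_of_subset_of_card_le
      (Finset.image_subset_iff.mpr (hst a ha))
      (Finset.card_image_of_injective _ (add_left_injective _)).ge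
    rw [← him, Finset.mem_image] at hx
    obtain ⟨y, hy, hyx⟩ := hx
    rwa [← add_right_cancel hyx]
  have h1 := one_mem_of_gcd_eq_one K A hA hK
  have hall : ∀ z : ℤ, z ∈ K := fun z => by
    simpa using K.zsmul_mem h1 z
  obtain ⟨x, hx⟩ := hS
  refine Finset.eq_univ_iff_forall.mpr fun y => ?_
  obtain ⟨z, hz⟩ := hφ (y - x)
  have := (hall z x).mpr hx
  rwa [hz, add_sub_cancel] at this

/-- Greedy choice of a transversal whose subset sums cover a finite quotient of `ℤ`. -/
theorem exists_transversal_cover {ι Q : Type*} [AddCommGroup Q] [Fintype Q] (φ : ℤ →+ Q)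
    (hφ : Function.Surjective φ) (A : ι → Finset ℕ) (hne : ∀ i, (A i).Nonempty)
    (hA : ∀ i, (A i).gcd id = 1)
    (R : Finset ι) (hR : Fintype.card Q ≤ R.card + 1) :
    ∃ x : ι → ℕ, (∀ i, x i ∈ A i) ∧ ∀ q : Q, ∃ I ⊆ R, φ ((∑ i ∈ I, x i : ℕ) : ℤ) = q := by
  suffices h : ∃ x : ι → ℕ, (∀ i, x i ∈ A i) ∧
      min (Fintype.card Q) (R.card + 1) ≤
        (R.powerset.image fun I => φ ((∑ i ∈ I, x i : ℕ) : ℤ)).card by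
    obtain ⟨x, hx, hc⟩ := h
    refine ⟨x, hx, fun q => ?_⟩
    rw [min_eq_left hR] at hc
    have := (Finset.card_eq_iff_eq_univ _).mp (le_antisymm (Finset.card_le_univ _) hc)
    have hq := this ▸ Finset.mem_univ q
    simpa using hq
  clear hR
  induction R using Finset.induction_on with
  | empty =>
    choose x hx using hne
    exact ⟨x, hx, by simp⟩
  | insert r R hr ih =>
    obtain ⟨x, hx, hc⟩ := ih
    set S := R.powerset.image fun I => φ ((∑ i ∈ I, x i : ℕ) : ℤ) with hSdef
    have hSsub : ∀ a ∈ A r, S ∪ S.image (· + φ a) ⊆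
        (insert r R).powerset.image fun I =>
          φ ((∑ i ∈ I, Function.update x r a i : ℕ) : ℤ) := by
      intro a _ q hq
      have hupd : ∀ I ⊆ R, ∑ i ∈ I, Function.update x r a i = ∑ i ∈ I, x i := fun I hI =>
        Finset.sum_congr rfl fun i hi =>
          Function.update_of_ne (fun h : i = r => hr (h ▸ hI hi)) _ _
      simp only [hSdef, Finset.mem_union, Finset.mem_image, Finset.mem_powerset] at hq ⊢
      rcases hq with ⟨I, hI, rfl⟩ | ⟨_, ⟨I, hI, rfl⟩, rfl⟩
      · exact ⟨I, hI.trans (Finset.subset_insert _ _), by rw [hupd I hI]⟩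
      · refine ⟨insert r I, Finset.insert_subset_insert _ hI, ?_⟩
        rw [Finset.sum_insert (fun h => hr (hI h)), hupd I hI, Function.update_self]
        push_cast
        rw [map_add, add_comm]
    have hmem : ∀ a ∈ A r, ∀ i, Function.update x r a i ∈ A i := by
      intro a ha i
      by_cases h : i = r
      · subst h; simpa using ha
      · rw [Function.update_of_ne h]; exact hx i
    by_cases hS : S = Finset.univ
    · obtain ⟨a, ha⟩ := hne r
      refine ⟨Function.update x r a, hmem a ha, (min_le_left _ _).trans ?_⟩
      rw [← Finset.card_univ, ← hS]
      exact Finset.card_le_card (Finset.subset_union_left.trans (hSsub a ha))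
    · have hSne : S.Nonempty := ⟨_, Finset.mem_image_of_mem _ (Finset.empty_mem_powerset R)⟩
      have hex : ∃ a ∈ A r, ∃ q ∈ S, q + φ a ∉ S := by
        by_contra! hcon
        exact hS (eq_univ_of_translate_subset φ hφ (A r) (hA r) S hSne hcon)
      obtain ⟨a, ha, q, hq, hqS⟩ := hex
      refine ⟨Function.update x r a, hmem a ha, le_trans ?_ (Finset.card_le_card (hSsub a ha))⟩
      have hlt : S.card < (S ∪ S.image (· + φ a)).card :=
        Finset.card_lt_card ⟨Finset.subset_union_left, fun h =>
          hqS (h (Finset.mem_union_right _ (Finset.mem_image_of_mem _ hq)))⟩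
      rw [Finset.card_insert_of_notMem hr]
      omega

/-- The subgroup generated by `T ∋ 0` is covered by few iterated sums of `T - T`: any sequence of
sets `U` with `0 ∈ U 0` and `U j + (T - T) ⊆ U (j + 1)` swallows it within `2 |⟨T⟩| / |T| - 1`
steps. -/
theorem exists_closure_subset_iterate {G : Type*} [AddCommGroup G] [Finite G] (T : Finset G)
    (hT : 0 ∈ T) (U : ℕ → Set G) (h0 : 0 ∈ U 0)
    (hU : ∀ j, ∀ x ∈ U j, ∀ t ∈ T, ∀ t' ∈ T, x + t - t' ∈ U (j + 1)) :
    ∃ D, T.card * (D + 1) ≤ 2 * Nat.card (AddSubgroup.closure (T : Set G)) ∧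
      ∀ x ∈ AddSubgroup.closure (T : Set G), x ∈ U D := by
  set H := AddSubgroup.closure (T : Set G) with hH
  have hTH : ∀ t ∈ T, t ∈ H := fun t ht => AddSubgroup.subset_closure ht
  let V : ℕ → Finset G := fun j =>
    Nat.rec {0} (fun _ S => (S ×ˢ T ×ˢ T).image fun p => p.1 + p.2.1 - p.2.2) j
  have hV0 : V 0 = {0} := rfl
  have hVs : ∀ j x, x ∈ V (j + 1) ↔ ∃ y ∈ V j, ∃ t ∈ T, ∃ t' ∈ T, y + t - t' = x := by
    intro j x
    simp only [V, Finset.mem_image, Finset.mem_product, Prod.exists]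
    constructor
    · rintro ⟨y, t, t', ⟨hy, ht, ht'⟩, h⟩; exact ⟨y, hy, t, ht, t', ht', h⟩
    · rintro ⟨y, hy, t, ht, t', ht', h⟩; exact ⟨y, t, t', ⟨hy, ht, ht'⟩, h⟩
  clear_value V
  have hmono : ∀ j, V j ⊆ V (j + 1) := fun j x hx =>
    (hVs j x).mpr ⟨x, hx, 0, hT, 0, hT, by simp⟩
  have hVU : ∀ j, ∀ x ∈ V j, x ∈ U j := by
    intro j
    induction j with
    | zero => intro x hx; rw [hV0, Finset.mem_singleton] at hx; rwa [hx]
    | succ j ih =>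
      intro x hx
      obtain ⟨y, hy, t, ht, t', ht', rfl⟩ := (hVs j x).mp hx
      exact hU j y (ih y hy) t ht t' ht'
  have hVH : ∀ j, ∀ x ∈ V j, x ∈ H := by
    intro j
    induction j with
    | zero => intro x hx; rw [hV0, Finset.mem_singleton] at hx; rw [hx]; exact H.zero_mem
    | succ j ih =>
      intro x hx
      obtain ⟨y, hy, t, ht, t', ht', rfl⟩ := (hVs j x).mp hx
      exact H.sub_mem (H.add_mem (ih y hy) (hTH t ht)) (hTH t' ht')
  have h0V : ∀ j, 0 ∈ V j := by
    intro j
    induction j with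
    | zero => simp [hV0]
    | succ j ih => exact hmono j ih
  let W : ℕ → Finset G := fun k => (V k ×ˢ T).image fun p => p.1 + p.2
  have hW : ∀ k x, x ∈ W k ↔ ∃ y ∈ V k, ∃ t ∈ T, y + t = x := by
    intro k x
    simp only [W, Finset.mem_image, Finset.mem_product, Prod.exists]
    constructor
    · rintro ⟨y, t, ⟨hy, ht⟩, h⟩; exact ⟨y, hy, t, ht, h⟩
    · rintro ⟨y, hy, t, ht, h⟩; exact ⟨y, t, ⟨hy, ht⟩, h⟩
  clear_value W
  have hWH : ∀ k, (W k).card ≤ Nat.card H := by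
    intro k
    have hs : (W k : Set G) ⊆ H := by
      intro x hx
      obtain ⟨y, hy, t, ht, rfl⟩ := (hW k x).mp hx
      exact H.add_mem (hVH k y hy) (hTH t ht)
    rw [← Set.ncard_coe_finset]
    exact Set.ncard_le_ncard hs (Set.toFinite _)
  have hgrow : ∀ k, (∀ j < 2 * k, V (j + 1) ≠ V j) → T.card * (k + 1) ≤ (W (2 * k)).card := by
    intro k
    induction k with
    | zero =>
      intro _
      rw [zero_add, mul_one]
      exact Finset.card_le_card fun t ht => (hW _ t).mpr ⟨0, h0V _, t, ht, zero_add t⟩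
    | succ k ih =>
      intro hne
      have ih' := ih fun j hj => hne j (by omega)
      obtain ⟨x, hx, hx'⟩ : ∃ x ∈ V (2 * k + 1 + 1), x ∉ V (2 * k + 1) := by
        by_contra! hcon
        exact hne (2 * k + 1) (by omega) (Finset.Subset.antisymm hcon (hmono _))
      have hdisj : Disjoint (W (2 * k)) (T.image (x + ·)) := by
        rw [Finset.disjoint_left]
        intro z hz hz'
        obtain ⟨y, hy, t, ht, rfl⟩ := (hW _ z).mp hz
        obtain ⟨t', ht', he⟩ := Finset.mem_image.mp hz'
        exact hx' ((hVs _ x).mpr ⟨y, hy, t, ht, t', ht', by rw [← he]; simp⟩)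
      have hsub : W (2 * k) ∪ T.image (x + ·) ⊆ W (2 * (k + 1)) := by
        intro z hz
        rcases Finset.mem_union.mp hz with hz | hz
        · obtain ⟨y, hy, t, ht, rfl⟩ := (hW _ z).mp hz
          exact (hW _ _).mpr ⟨y, hmono _ (hmono _ hy), t, ht, rfl⟩
        · obtain ⟨t, ht, rfl⟩ := Finset.mem_image.mp hz
          exact (hW _ _).mpr ⟨x, hx, t, ht, rfl⟩
      have hc := Finset.card_le_card hsub
      rw [Finset.card_union_of_disjoint hdisj,
        Finset.card_image_of_injective _ (add_right_injective x)] at hc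
      linarith
  have hTpos : 0 < T.card := Finset.card_pos.mpr ⟨0, hT⟩
  have hex : ∃ D, V (D + 1) = V D := by
    by_contra! hcon
    have h1 := (hgrow (Nat.card H) fun j _ => hcon j).trans (hWH _)
    nlinarith
  refine ⟨Nat.find hex, ?_, ?_⟩
  · have h1 := (hgrow (Nat.find hex / 2) fun j hj => Nat.find_min hex (by omega)).trans (hWH _)
    have h2 : Nat.find hex + 1 ≤ 2 * (Nat.find hex / 2 + 1) := by omega
    calc T.card * (Nat.find hex + 1) ≤ T.card * (2 * (Nat.find hex / 2 + 1)) :=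
          Nat.mul_le_mul_left _ h2
      _ ≤ 2 * Nat.card H := by linarith
  · have hst := Nat.find_spec hex
    set D := Nat.find hex
    have hclosed : ∀ x ∈ H, ∀ y ∈ V D, y + x ∈ V D := by
      intro x hx
      rw [hH] at hx
      induction hx using AddSubgroup.closure_induction_left with
      | zero => simp
      | add_left t ht x _ ih =>
        intro y hy
        rw [← add_assoc]
        refine ih _ ?_
        rw [← hst]
        exact (hVs D _).mpr ⟨y, hy, t, ht, 0, hT, by simp⟩
      | neg_add_cancel t ht x _ ih =>
        intro y hy
        rw [← add_assoc]
        refine ih _ ?_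
        rw [← hst]
        exact (hVs D _).mpr ⟨y, hy, 0, hT, t, ht, by simp [sub_eq_add_neg]⟩
    intro x hx
    have := hclosed x hx 0 (h0V D)
    rw [zero_add] at this
    exact hVU D x this

/-- Any combination `∑ p b * b` respecting the multiplicities of `f` on `N` is a subset sum. -/
theorem exists_subset_sum_eq {ι : Type*} (f : ι → ℕ) (N : Finset ι) (B : Finset ℕ) (p : ℕ → ℕ)
    (hp : ∀ b ∈ B, p b ≤ (N.filter fun i => f i = b).card) :
    ∃ I ⊆ N, ∑ i ∈ I, f i = ∑ b ∈ B, p b * b := by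
  have hK : ∀ b, ∃ K ⊆ N.filter (fun i => f i = b), b ∈ B → K.card = p b := by
    intro b
    by_cases hb : b ∈ B
    · obtain ⟨K, hK, hc⟩ := Finset.exists_subset_card_eq (hp b hb)
      exact ⟨K, hK, fun _ => hc⟩
    · exact ⟨∅, by simp, fun h => absurd h hb⟩
  choose K hK hKc using hK
  refine ⟨B.biUnion K, Finset.biUnion_subset.mpr fun b _ =>
    (hK b).trans (Finset.filter_subset _ _), ?_⟩
  have hf : ∀ b, ∀ i ∈ K b, f i = b := fun b i hi => (Finset.mem_filter.mp (hK b hi)).2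
  rw [Finset.sum_biUnion]
  · refine Finset.sum_congr rfl fun b hb => ?_
    rw [Finset.sum_congr rfl (hf b), Finset.sum_const, smul_eq_mul, hKc b hb]
  · intro b _ b' _ hbb
    exact Finset.disjoint_left.mpr fun i hi hi' => hbb ((hf b i hi).symm.trans (hf b' i hi'))

set_option maxHeartbeats 1000000 in
/-- If the numbers in `B ∪ {l}`, with maximum `l ≤ w`, all occur often enough in a
transversal `f` outside a reserve `R` of size at least `w`, then modifying `f` on `R` gives a
transversal whose subset sums contain `w + 1` consecutive integers. -/
theorem exists_interval_of_popular {ι : Type*} (w : ℕ) (A : ι → Finset ℕ)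
    (hne : ∀ i, (A i).Nonempty) (hsub : ∀ i, ∀ a ∈ A i, a ≤ w) (hgcd : ∀ i, (A i).gcd id = 1)
    (f : ι → ℕ) (hf : ∀ i, f i ∈ A i) (R N : Finset ι) (hRN : Disjoint R N) (hR : w ≤ R.card)
    (l : ℕ) (hl : 0 < l) (hlw : l ≤ w) (B : Finset ℕ) (hB : ∀ b ∈ B, 0 < b ∧ b < l) (h : ℕ)
    (hh : ∀ b ∈ insert l B, h ≤ (N.filter fun i => f i = b).card)
    (hcard : 5 * w ≤ (B.card + 1) * (h + 2)) :
    ∃ x : ι → ℕ, (∀ i, x i ∈ A i) ∧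
      ∃ z : ℕ, ∀ m : ℕ, z ≤ m → m ≤ z + w → ∃ I : Finset ι, ∑ i ∈ I, x i = m := by
  have : NeZero l := ⟨hl.ne'⟩
  have hlB : l ∉ B := fun hl' => (hB l hl').2.false
  set T : Finset (ZMod l) := (insert 0 B).image (fun b : ℕ => (b : ZMod l)) with hTdef
  have hTcard : T.card = B.card + 1 := by
    rw [hTdef, Finset.card_image_of_injOn, Finset.card_insert_of_notMem]
    · exact fun h0 => (hB 0 h0).1.false
    · have hlt : ∀ b ∈ insert 0 B, b < l := by
        intro b hb
        rcases Finset.mem_insert.mp hb with rfl | hb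
        exacts [hl, (hB b hb).2]
      intro a ha b hb hab
      have := (ZMod.natCast_eq_natCast_iff' a b l).mp hab
      rwa [Nat.mod_eq_of_lt (hlt a ha), Nat.mod_eq_of_lt (hlt b hb)] at this
  have hT0 : (0 : ZMod l) ∈ T := Finset.mem_image.mpr ⟨0, by simp, by simp⟩
  obtain ⟨D, hD, hcov⟩ := exists_closure_subset_iterate T hT0
    (fun j => {x | ∃ ε : ℕ → ℤ, (∀ b ∈ B, |ε b| ≤ j) ∧ |∑ b ∈ B, ε b * b| ≤ j * l ∧
      ((∑ b ∈ B, ε b * b : ℤ) : ZMod l) = x}) ⟨0, by simp, by simp, by simp⟩ (by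
    rintro j x ⟨ε, h1, h2, h3⟩ t ht t' ht'
    obtain ⟨a, ha, rfl⟩ := Finset.mem_image.mp ht
    obtain ⟨a', ha', rfl⟩ := Finset.mem_image.mp ht'
    have hlt : ∀ b ∈ insert 0 B, b < l := by
      intro b hb
      rcases Finset.mem_insert.mp hb with rfl | hb
      exacts [hl, (hB b hb).2]
    have hsingle : ∀ a ∈ insert 0 B, ∑ b ∈ B, (if b = a then (1 : ℤ) else 0) * b = a := by
      intro a ha
      simp only [ite_mul, one_mul, zero_mul, Finset.sum_ite_eq']
      rcases Finset.mem_insert.mp ha with rfl | ha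
      · simp
      · simp [ha]
    have hsum : ∑ b ∈ B, (ε b + (if b = a then 1 else 0) - (if b = a' then 1 else 0)) * (b : ℤ)
        = ∑ b ∈ B, ε b * b + a - a' := by
      simp only [sub_mul, add_mul, Finset.sum_sub_distrib, Finset.sum_add_distrib]
      rw [hsingle a ha, hsingle a' ha']
    refine ⟨fun b => ε b + (if b = a then 1 else 0) - (if b = a' then 1 else 0), ?_, ?_, ?_⟩
    · intro b hb
      have := abs_le.mp (h1 b hb)
      push_cast
      rw [abs_le]
      split_ifs <;> constructor <;> linarith
    · rw [hsum]
      have h4 := abs_le.mp h2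
      have h5 := hlt a ha
      have h6 := hlt a' ha'
      zify at h5 h6
      push_cast
      rw [abs_le]
      constructor <;> linarith
    · rw [hsum, ← h3]
      push_cast
      ring)
  set H := AddSubgroup.closure (T : Set (ZMod l)) with hH
  rw [hTcard] at hD
  have hTH : B.card + 1 ≤ Nat.card H := by
    rw [← hTcard, ← Set.ncard_coe_finset]
    exact Set.ncard_le_ncard AddSubgroup.subset_closure (Set.toFinite _)
  let _ : Fintype (ZMod l ⧸ H) := Fintype.ofFinite _
  set g := Fintype.card (ZMod l ⧸ H) with hg
  have hgpos : 0 < g := Fintype.card_pos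
  have hgl : g * Nat.card H = l := by
    rw [hg, ← Nat.card_eq_fintype_card, ← AddSubgroup.card_eq_card_quotient_mul_card_addSubgroup,
      Nat.card_zmod]
  have hgw : g ≤ w := by nlinarith
  obtain ⟨R', hR'R, hR'⟩ := Finset.exists_subset_card_eq (show g - 1 ≤ R.card by omega)
  obtain ⟨y, hyA, hy⟩ := exists_transversal_cover
    ((QuotientAddGroup.mk' H).comp (Int.castAddHom (ZMod l)))
    ((QuotientAddGroup.mk'_surjective H).comp ZMod.intCast_surjective) A hne hgcd R'
    (by omega)
  have hxR : ∀ I ⊆ R', ∑ i ∈ I, (if i ∈ R' then y i else f i) = ∑ i ∈ I, y i := fun I hI =>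
    Finset.sum_congr rfl fun i hi => if_pos (hI hi)
  have hxN : ∀ I ⊆ N, ∑ i ∈ I, (if i ∈ R' then y i else f i) = ∑ i ∈ I, f i := fun I hI =>
    Finset.sum_congr rfl fun i hi =>
      if_neg fun hi' => Finset.disjoint_left.mp hRN (hR'R hi') (hI hi)
  refine ⟨fun i => if i ∈ R' then y i else f i, fun i => ?_,
    (g - 1) * w + D * (∑ b ∈ B, b) + D * l, fun m hm1 hm2 => ?_⟩
  · dsimp only
    split_ifs
    exacts [hyA i, hf i]
  obtain ⟨IR, hIR, hq⟩ := hy (((m : ℤ) - (D * (∑ b ∈ B, b) : ℕ) : ℤ) : ZMod l)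
  have hyle : ∑ i ∈ IR, y i ≤ (g - 1) * w := by
    calc ∑ i ∈ IR, y i ≤ IR.card • w :=
          Finset.sum_le_card_nsmul _ _ _ fun i _ => hsub i _ (hyA i)
      _ ≤ (g - 1) * w := by
          rw [smul_eq_mul]
          exact Nat.mul_le_mul_right _ (hR' ▸ Finset.card_le_card hIR)
  set Y := ∑ i ∈ IR, y i with hY
  have hmem := QuotientAddGroup.eq.mp hq
  obtain ⟨ε, hε1, hε2, hε3⟩ := hcov _ hmem
  set E := ∑ b ∈ B, ε b * (b : ℤ) with hE
  set c := D * ∑ b ∈ B, b with hc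
  have hdvd : (l : ℤ) ∣ (m : ℤ) - c - Y - E := by
    rw [← ZMod.intCast_zmod_eq_zero_iff_dvd]
    have h7 : ((E : ℤ) : ZMod l) = -(Y : ZMod l) + ((m : ZMod l) - c) := by
      rw [hε3]; simp
    push_cast
    rw [h7]
    ring
  obtain ⟨q, hqe⟩ := hdvd
  have hE' := abs_le.mp hε2
  have hbound : 2 * D * l + g * w ≤ h * l := by
    have h8 : (B.card + 1) * (2 * D + 2) ≤ 4 * w := by nlinarith
    have h9 : (B.card + 1) * g ≤ l := by nlinarith
    have h10 : (B.card + 1) * (2 * D * l + g * w) ≤ (B.card + 1) * (h * l) := by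
      have h11 := Nat.mul_le_mul_right l h8
      have h12 := Nat.mul_le_mul_right w h9
      have h13 := Nat.mul_le_mul_right l hcard
      nlinarith
    exact Nat.le_of_mul_le_mul_left h10 (by omega)
  have h2D : 2 * D ≤ h := by
    refine Nat.le_of_mul_le_mul_right (c := l) ?_ hl
    omega
  have hg1 : (g - 1) * w + w = g * w := by
    obtain ⟨k, hk⟩ := Nat.exists_eq_add_of_lt hgpos
    rw [hk]; simp; ring
  have hlZ : (0 : ℤ) < l := by exact_mod_cast hl
  have hq0 : 0 ≤ q := by
    refine nonneg_of_mul_nonneg_right (a := (l : ℤ)) ?_ hlZ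
    rw [← hqe]
    zify at hm1 hyle
    linarith
  have hqh : q ≤ h := by
    refine le_of_mul_le_mul_left (a := (l : ℤ)) ?_ hlZ
    rw [← hqe]
    zify at hm2 hbound hg1
    have : (0 : ℤ) ≤ Y := by positivity
    linarith
  let p : ℕ → ℕ := fun b => if b = l then q.toNat else (D + ε b).toNat
  have hpB : ∀ b ∈ B, (p b : ℤ) = D + ε b := by
    intro b hb
    have hbl : b ≠ l := fun hbl => hlB (hbl ▸ hb)
    have := abs_le.mp (hε1 b hb)
    simp only [p, if_neg hbl]
    exact Int.toNat_of_nonneg (by linarith)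
  have hpl : (p l : ℤ) = q := by simp [p, hq0]
  have hph : ∀ b ∈ insert l B, p b ≤ (N.filter fun i => f i = b).card := by
    intro b hb
    refine le_trans ?_ (hh b hb)
    rcases Finset.mem_insert.mp hb with rfl | hb
    · omega
    · have h14 := abs_le.mp (hε1 b hb)
      have h15 := hpB b hb
      omega
  obtain ⟨IN, hIN, hINsum⟩ := exists_subset_sum_eq f N (insert l B) p hph
  refine ⟨IR ∪ IN, ?_⟩
  rw [Finset.sum_union (hRN.mono (hIR.trans hR'R) hIN), hxR IR hIR, hxN IN hIN, hINsum,
    Finset.sum_insert hlB]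
  have hsumB : ((∑ b ∈ B, p b * b : ℕ) : ℤ) = c + E := by
    push_cast [hc, hE]
    rw [Finset.mul_sum, ← Finset.sum_add_distrib]
    exact Finset.sum_congr rfl fun b hb => by rw [hpB b hb]; ring
  zify at hsumB ⊢
  rw [hsumB, hpl]
  linarith

/-- Proposition 6.2 (subset sums of transversals contain a long interval). -/
theorem transversal_contains_interval (s w : ℕ) (hs : 3 ≤ s) (hw : 3 ≤ w)
    (A : Fin s → Finset ℕ) (hne : ∀ i, (A i).Nonempty) (hsub : ∀ i, ∀ a ∈ A i, a ≤ w)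
    (hgcd : ∀ i, (A i).gcd id = 1)
    (hcase : (10 * (w : ℝ) * Real.log w ≤ (s : ℝ)) ∨ (10 * w ≤ s ∧ ∀ i j, A i = A j)) :
    ∃ x : Fin s → ℕ, (∀ i, x i ∈ A i) ∧
      ∃ z : ℕ, ∀ m : ℕ, z ≤ m → m ≤ z + w →
        ∃ I : Finset (Fin s), ∑ i ∈ I, x i = m := by
  classical
  have hpos : ∀ i, ∃ a ∈ A i, 0 < a := by
    intro i
    by_contra! hcon
    have h0 : (A i).gcd id = 0 := Finset.gcd_eq_zero_iff.mpr fun a ha => by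
      simpa using hcon a ha
    rw [hgcd i] at h0
    exact one_ne_zero h0
  have hlog : 1 ≤ Real.log w := by
    rw [Real.le_log_iff_exp_le (by positivity)]
    have h3 : (3 : ℝ) ≤ w := by exact_mod_cast hw
    linarith [Real.exp_one_lt_d9]
  have hwR : (0 : ℝ) < w := by positivity
  have hws : w ≤ s := by
    rcases hcase with h | ⟨h, -⟩
    · have : (w : ℝ) ≤ s := by nlinarith
      exact_mod_cast this
    · omega
  obtain ⟨R, -, hR⟩ := Finset.exists_subset_card_eq
    (show w ≤ (Finset.univ : Finset (Fin s)).card by simpa using hws)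
  have hRc : Rᶜ.card = s - w := by rw [Finset.card_compl, hR, Fintype.card_fin]
  rcases hcase with hs' | ⟨hs', hAA⟩
  · choose f hf hf0 using hpos
    set μ : ℕ → ℕ := fun b => (Rᶜ.filter fun i => f i = b).card with hμ
    have htot : ∑ b ∈ Finset.Icc 1 w, μ b = s - w := by
      rw [← hRc]
      exact (Finset.card_eq_sum_card_fiberwise fun i _ =>
        Finset.mem_coe.mpr (Finset.mem_Icc.mpr ⟨hf0 i, hsub i _ (hf i)⟩)).symm
    have hex : ∃ B ⊆ Finset.Icc 1 w, B.Nonempty ∧ ∃ h, (∀ b ∈ B, h ≤ μ b) ∧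
        5 * w ≤ B.card * (h + 2) := by
      by_contra! hcon
      have h1 := sum_add_two_le_mul_harmonic μ (5 * w) (Finset.Icc 1 w) hcon
      have h2 := harmonic_le_one_add_log w
      have h3 : (∑ b ∈ Finset.Icc 1 w, (μ b : ℝ)) = s - w := by
        rw [← Nat.cast_sum, htot, Nat.cast_sub hws]
      rw [Finset.sum_add_distrib, h3, Finset.sum_const, Nat.card_Icc, nsmul_eq_mul] at h1
      simp only [Nat.add_sub_cancel, Nat.cast_mul, Nat.cast_ofNat] at h1
      nlinarith
    obtain ⟨B, hB, hBne, h, hBh, hcard⟩ := hex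
    have hl := Finset.mem_Icc.mp (hB (B.max'_mem hBne))
    refine exists_interval_of_popular w A hne hsub hgcd f hf R Rᶜ disjoint_compl_right hR.ge
      (B.max' hBne) hl.1 hl.2 (B.erase (B.max' hBne)) (fun b hb => ?_) h ?_ ?_
    · exact ⟨(Finset.mem_Icc.mp (hB (Finset.mem_of_mem_erase hb))).1,
        B.lt_max'_of_mem_erase_max' hBne hb⟩
    · rw [Finset.insert_erase (B.max'_mem hBne)]
      exact hBh
    · rwa [Finset.card_erase_add_one (B.max'_mem hBne)]
  · obtain ⟨a, ha, ha0⟩ := hpos ⟨0, by omega⟩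
    have hf : ∀ i, a ∈ A i := fun i => hAA i ⟨0, by omega⟩ ▸ ha
    refine exists_interval_of_popular w A hne hsub hgcd (fun _ => a) hf R Rᶜ
      disjoint_compl_right hR.ge a ha0 (hsub _ a ha) ∅ (by simp) (s - w) ?_ ?_
    · intro b hb
      rw [insert_empty_eq, Finset.mem_singleton] at hb
      simp [hb, ← hRc]
    · simp only [Finset.card_empty]
      omega

end Paper
end

section
/- Let k, s₁, s₂ be positive integers and p₁, p₂ non-negative integers. Suppose W₁ and W₂ are vertex-disjoint graphs such that W₁ is properly (respectively, topologically) (k, s₁, p₁)-flexi-chromatic with central colouring φ₁ and W₂ is properly (respectively, topologically) (k, s₂, p₂)-flexi-chromatic with central colouring φ₂. If s₂ ≥ p₁, then W₁ ∪ W₂ is properly (respectively, topologically) (k, s₁, p₂)-flexi-chromatic, and φ₁ ∪ φ₂ is a central colouring witnessing this. -/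
open scoped Classical

namespace Paper

theorem sum_classCard {V : Type} [Fintype V] {k : ℕ} {C : V → ℕ} (hC : ∀ v, C v < k) :
    ∑ i : Fin k, (classCard C (i : ℕ) : ℤ) = Fintype.card V := by
  have h := Finset.card_eq_sum_card_fiberwise (s := Finset.univ) (t := Finset.range k) (f := C)
    fun v _ ↦ Finset.mem_coe.2 (Finset.mem_range.2 (hC v))
  rw [Finset.card_univ] at h
  rw [h, Fin.sum_univ_eq_sum_range (fun i ↦ (classCard C i : ℤ)), Nat.cast_sum]
  refine Finset.sum_congr rfl fun i _ ↦ ?_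
  rw [classCard, Set.ncard_eq_toFinset_card', Set.toFinset_ofPred]

theorem classCard_sumElim {V₁ V₂ : Type} [Finite V₁] [Finite V₂] (C₁ : V₁ → ℕ) (C₂ : V₂ → ℕ)
    (i : ℕ) : classCard (Sum.elim C₁ C₂) i = classCard C₁ i + classCard C₂ i := by
  have h : {v | Sum.elim C₁ C₂ v = i} = Sum.inl '' {v | C₁ v = i} ∪ Sum.inr '' {v | C₂ v = i} := by
    ext (v | v) <;> simp
  rw [classCard, h, Set.ncard_union_eq (by simp [Set.disjoint_left]),
    Set.ncard_image_of_injective _ Sum.inl_injective,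
    Set.ncard_image_of_injective _ Sum.inr_injective, classCard, classCard]

theorem ProperCol.sumElim {V₁ V₂ : Type} {W₁ : SimpleGraph V₁} {W₂ : SimpleGraph V₂} {k : ℕ}
    {C₁ : V₁ → ℕ} {C₂ : V₂ → ℕ} (h₁ : ProperCol W₁ k C₁) (h₂ : ProperCol W₂ k C₂) :
    ProperCol (W₁ ⊕g W₂) k (Sum.elim C₁ C₂) := by
  refine ⟨Sum.rec h₁.1 h₂.1, ?_⟩
  rintro (u | u) (v | v) huv
  · exact h₁.2 huv
  · cases huv
  · cases huv
  · exact h₂.2 huv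

theorem TopCol.sumElim {V₁ V₂ : Type} {W₁ : SimpleGraph V₁} {W₂ : SimpleGraph V₂} {k : ℕ}
    {C₁ : V₁ → ℕ} {C₂ : V₂ → ℕ} (h₁ : TopCol W₁ k C₁) (h₂ : TopCol W₂ k C₂) :
    TopCol (W₁ ⊕g W₂) k (Sum.elim C₁ C₂) := by
  refine ⟨Sum.rec h₁.1 h₂.1, ?_⟩
  rintro (u | u) (v | v) huv
  · exact h₁.2 huv
  · cases huv
  · cases huv
  · exact h₂.2 huv

/-- The error left by the first graph has zero sum, so the second graph can absorb it. -/
theorem ApproxFlexiWith.sumElim {V₁ V₂ : Type} [Fintype V₁] [Fintype V₂]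
    {Col₁ : ℕ → (V₁ → ℕ) → Prop} {Col₂ : ℕ → (V₂ → ℕ) → Prop}
    {Col : ℕ → (V₁ ⊕ V₂ → ℕ) → Prop} {k s₁ s₂ p₁ p₂ : ℕ} {φ₁ : V₁ → ℕ} {φ₂ : V₂ → ℕ}
    (hlt : ∀ C, Col₁ k C → ∀ v, C v < k)
    (hCol : ∀ C₁ C₂, Col₁ k C₁ → Col₂ k C₂ → Col k (Sum.elim C₁ C₂)) (h : p₁ ≤ s₂)
    (h₁ : ApproxFlexiWith Col₁ k s₁ p₁ φ₁) (h₂ : ApproxFlexiWith Col₂ k s₂ p₂ φ₂) :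
    ApproxFlexiWith Col k s₁ p₂ (Sum.elim φ₁ φ₂) := by
  refine ⟨hCol _ _ h₁.1 h₂.1, fun w hw hws ↦ ?_⟩
  obtain ⟨ψ₁, hψ₁, he₁⟩ := h₁.2 w hw hws
  obtain ⟨ψ₂, hψ₂, he₂⟩ := h₂.2
    (fun i ↦ -((classCard φ₁ (i : ℕ) : ℤ) - classCard ψ₁ (i : ℕ) - w i))
    (by simp only [Finset.sum_neg_distrib, Finset.sum_sub_distrib, hw,
          sum_classCard (hlt _ h₁.1), sum_classCard (hlt _ hψ₁), sub_self, neg_zero])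
    (fun i ↦ by rw [abs_neg]; exact (he₁ i).trans (by exact_mod_cast h))
  refine ⟨Sum.elim ψ₁ ψ₂, hCol _ _ hψ₁ hψ₂, fun i ↦ ?_⟩
  rw [classCard_sumElim, classCard_sumElim]
  convert he₂ i using 2
  push_cast
  ring

/-- Proposition 11.2 (gluing flexi-chromatic graphs). -/
theorem wild_sum {V₁ V₂ : Type} [Fintype V₁] [Fintype V₂] (k s₁ s₂ p₁ p₂ : ℕ)
    (hk : 0 < k) (hs₁ : 0 < s₁) (hs₂ : 0 < s₂) (h : p₁ ≤ s₂)
    (W₁ : SimpleGraph V₁) (W₂ : SimpleGraph V₂) (φ₁ : V₁ → ℕ) (φ₂ : V₂ → ℕ) :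
    (ApproxFlexiWith (ProperCol W₁) k s₁ p₁ φ₁ →
      ApproxFlexiWith (ProperCol W₂) k s₂ p₂ φ₂ →
      ApproxFlexiWith (ProperCol (W₁ ⊕g W₂)) k s₁ p₂ (Sum.elim φ₁ φ₂)) ∧
    (ApproxFlexiWith (TopCol W₁) k s₁ p₁ φ₁ →
      ApproxFlexiWith (TopCol W₂) k s₂ p₂ φ₂ →
      ApproxFlexiWith (TopCol (W₁ ⊕g W₂)) k s₁ p₂ (Sum.elim φ₁ φ₂)) := by
  exact ⟨ApproxFlexiWith.sumElim (fun _ hC ↦ hC.1) (fun _ _ ↦ ProperCol.sumElim) h,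
    ApproxFlexiWith.sumElim (fun _ hC ↦ hC.1) (fun _ _ ↦ TopCol.sumElim) h⟩

end Paper
end

section
/- Let F be a graph on w vertices with maximum degree Δ(F) = Δ, chromatic number χ(F) = k ≥ 3 and α(F) < 1/(Δ+1). Then there exists a proper k-colouring φ of F with the following property: for every non-negative integer y with y < (w/k)(1/(Δ+1) − α(F)), there exists a proper k-colouring φ′ of F with ord(φ′)(i) = ord(φ)(i) for all i ∈ [k−2] and ord(φ′)(k) = ord(φ)(k) + y. -/
open scoped Classical

namespace Paper

/-- In a graph of maximum degree at most `Δ`, every independent set extends to an independent set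
containing at least a `1 / (Δ + 1)` proportion of the vertices. -/
theorem exists_indepSet_superset {V : Type} [Fintype V] (G : SimpleGraph V) {Δ : ℕ}
    (hΔ : ∀ v, ndeg G v ≤ Δ) (A : Finset V) (hA : G.IsIndepSet (A : Set V)) :
    ∃ I : Finset V, A ⊆ I ∧ G.IsIndepSet (I : Set V) ∧ Fintype.card V ≤ I.card * (Δ + 1) := by
  obtain ⟨I, hAI, hI⟩ :=
    Finite.exists_le_maximal (p := fun I : Finset V => G.IsIndepSet (I : Set V)) hA
  refine ⟨I, hAI, hI.prop, ?_⟩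
  have hcover : (Finset.univ : Finset V) ⊆
      I.biUnion fun v => insert v (G.neighborSet v).toFinset := by
    intro x _
    simp only [Finset.mem_biUnion, Finset.mem_insert, Set.mem_toFinset,
      SimpleGraph.mem_neighborSet]
    by_contra! hx
    have hxI : x ∉ I := fun h => (hx x h).1 rfl
    have hins : G.IsIndepSet ((insert x I : Finset V) : Set V) := by
      rw [Finset.coe_insert]
      exact Set.Pairwise.insert hI.prop fun v hv _ => ⟨fun h => (hx v hv).2 h.symm, (hx v hv).2⟩
    exact hxI (hI.le_of_ge hins (Finset.subset_insert x I) (Finset.mem_insert_self x I))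
  refine (Finset.card_le_card hcover).trans (Finset.card_biUnion_le_card_mul _ _ _ fun v _ => ?_)
  refine (Finset.card_insert_le _ _).trans (Nat.succ_le_succ ?_)
  rw [← Set.ncard_eq_toFinset_card']
  exact hΔ v

/-- `α(F)` is attained by a colour class of some proper `χ(F)`-colouring. -/
theorem exists_classCard_eq_alphaNat {V : Type} [Fintype V] (G : SimpleGraph V) {k : ℕ}
    (hk : G.chromaticNumber = (k : ℕ∞)) (hpos : 0 < k) :
    ∃ C, ProperCol G k C ∧ ∃ i < k, classCard C i = alphaNat G := by
  have hnum : chromNum G = k := by simp [chromNum, hk]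
  obtain ⟨c⟩ : G.Colorable k := SimpleGraph.chromaticNumber_le_iff_colorable.mp hk.le
  have halpha : alphaNat G = sInf {a | ∃ C, ProperCol G k C ∧ a = minClassCard C k} := by
    rw [alphaNat, hnum]
  have hne : {a | ∃ C, ProperCol G k C ∧ a = minClassCard C k}.Nonempty :=
    ⟨_, fun v => (c v : ℕ), ⟨fun v => (c v).isLt, fun _ _ h e => c.valid h (Fin.ext e)⟩, rfl⟩
  obtain ⟨C, hC, hCa⟩ := Nat.sInf_mem hne
  have hne' : {a | ∃ i < k, a = classCard C i}.Nonempty := ⟨_, 0, hpos, rfl⟩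
  obtain ⟨i, hi, hia⟩ := Nat.sInf_mem hne'
  exact ⟨C, hC, i, hi, hia.symm.trans (hCa.symm.trans halpha.symm)⟩

/-- Any two distinct colours can be renamed to the last and the second to last colour. -/
theorem exists_perm_last_two {k i j : ℕ} (hi : i < k) (hj : j < k) (hij : j ≠ i) :
    ∃ σ : Equiv.Perm ℕ, (∀ x < k, σ x < k) ∧ σ i = k - 1 ∧ σ j = k - 2 := by
  refine ⟨(Equiv.swap i (k - 1)).trans (Equiv.swap (Equiv.swap i (k - 1) j) (k - 2)), ?_, ?_, ?_⟩
  · intro x hx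
    simp only [Equiv.trans_apply, Equiv.swap_apply_def]
    grind
  · have h : Equiv.swap i (k - 1) j ≠ k - 1 := by
      simp only [Equiv.swap_apply_def]
      grind
    rw [Equiv.trans_apply, Equiv.swap_apply_left,
      Equiv.swap_apply_of_ne_of_ne h.symm (by omega)]
  · simp

theorem ProperCol.comp_perm {V : Type} {G : SimpleGraph V} {k : ℕ} {C : V → ℕ}
    (hC : ProperCol G k C) {σ : Equiv.Perm ℕ} (hσ : ∀ x < k, σ x < k) :
    ProperCol G k (σ ∘ C) :=
  ⟨fun v => hσ _ (hC.1 v), fun _ _ h e => hC.2 h (σ.injective e)⟩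

/-- Moving vertices of colour `b` to colour `a`, when together with the colour class of `a` they
lie in an independent set. -/
theorem ProperCol.exists_move {V : Type} [Fintype V] {G : SimpleGraph V} {k a b : ℕ} {φ : V → ℕ}
    (hφ : ProperCol G k φ) (ha : a < k) (hab : a ≠ b) {I T : Finset V}
    (hI : G.IsIndepSet (I : Set V)) (haI : ∀ v, φ v = a → v ∈ I) (hTI : T ⊆ I)
    (hT : ∀ v ∈ T, φ v = b) :
    ∃ φ', ProperCol G k φ' ∧ (∀ i, i ≠ a → i ≠ b → classCard φ' i = classCard φ i) ∧
      classCard φ' a = classCard φ a + T.card := by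
  have hind : ∀ ⦃u v⦄, u ∈ I → v ∈ I → ¬ G.Adj u v := fun u v hu hv h => hI hu hv h.ne h
  refine ⟨fun v => if v ∈ T then a else φ v, ⟨fun v => ?_, fun u v huv => ?_⟩,
    fun i hia hib => ?_, ?_⟩
  · dsimp only
    split_ifs
    exacts [ha, hφ.1 v]
  · have huv' := hφ.2 huv
    have hnot := @hind u v
    have hu := haI u
    have hv := haI v
    dsimp only
    grind
  · unfold classCard
    congr 1
    ext v
    have := hT v
    simp only [Set.mem_ofPred_eq]
    grind
  · have hset : {v | (if v ∈ T then a else φ v) = a} = {v | φ v = a} ∪ (T : Set V) := by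
      ext v
      simp only [Set.mem_ofPred_eq, Set.mem_union, Finset.mem_coe]
      grind
    have hdisj : Disjoint {v | φ v = a} (T : Set V) := by
      rw [Set.disjoint_left]
      exact fun v hv hvT => hab (hv.symm.trans (hT v hvT))
    unfold classCard
    rw [hset, Set.ncard_union_eq hdisj, Set.ncard_coe_finset]

/-- Proposition 6.5 (low `α` gives colour class flexibility). -/
theorem max_degree_gives_wildcards {W : Type} [Fintype W] (F : SimpleGraph W) (w k Δ : ℕ)
    (hw : Fintype.card W = w) (hk : F.chromaticNumber = (k : ℕ∞)) (hk3 : 3 ≤ k)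
    (hΔub : ∀ v, ndeg F v ≤ Δ) (hΔeq : ∃ v, ndeg F v = Δ)
    (hα : alphaR F < 1 / ((Δ : ℝ) + 1)) :
    ∃ φ, ProperCol F k φ ∧ ∀ y : ℕ,
      (y : ℝ) < ((w : ℝ) / (k : ℝ)) * (1 / ((Δ : ℝ) + 1) - alphaR F) →
      ∃ φ', ProperCol F k φ' ∧ (∀ i : ℕ, i < k - 2 → classCard φ' i = classCard φ i) ∧
        classCard φ' (k - 1) = classCard φ (k - 1) + y := by
  obtain ⟨C, hC, i, hi, hia⟩ := exists_classCard_eq_alphaNat F hk (by omega)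
  set A : Finset W := Finset.univ.filter fun v => C v = i with hAdef
  have hAcard : A.card = alphaNat F := by
    rw [← hia, classCard, Set.ncard_eq_toFinset_card']
    congr 1
    ext v
    simp [hAdef]
  have hAind : F.IsIndepSet (A : Set W) := by
    intro u hu v hv _ h
    simp only [hAdef, Finset.coe_filter, Finset.mem_univ, true_and, Set.mem_ofPred_eq] at hu hv
    exact hC.2 h (hu.trans hv.symm)
  obtain ⟨I, hAI, hI, hIcard⟩ := exists_indepSet_superset F hΔub A hAind
  set b : ℝ := ((w : ℝ) / (k : ℝ)) * (1 / ((Δ : ℝ) + 1) - alphaR F) with hb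
  have hk0 : (0 : ℝ) < k := by exact_mod_cast (by omega : 0 < k)
  have hb0 : 0 ≤ b := mul_nonneg (by positivity) (sub_nonneg.mpr hα.le)
  have hw0 : (0 : ℝ) < w := by
    obtain ⟨v, _⟩ := hΔeq
    rw [← hw]
    exact_mod_cast Fintype.card_pos_iff.mpr ⟨v⟩
  have hkb : k * b = w / ((Δ : ℝ) + 1) - A.card := by
    rw [hb, alphaR, hw, hAcard]
    field_simp
  have hIreal : (w : ℝ) / ((Δ : ℝ) + 1) ≤ I.card := by
    rw [div_le_iff₀ (by positivity)]
    exact_mod_cast hw ▸ hIcard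
  obtain ⟨j, hj, hbj⟩ := Finset.exists_le_card_fiber_of_nsmul_le_card_of_maps_to
    (s := I \ A) (t := (Finset.range k).erase i) (f := C) (b := b)
    (fun v hv => by
      simp only [hAdef, Finset.mem_sdiff, Finset.mem_filter, Finset.mem_univ, true_and] at hv
      exact Finset.mem_erase.mpr ⟨hv.2, Finset.mem_range.mpr (hC.1 v)⟩)
    (by
      rw [← Finset.card_pos, Finset.card_erase_of_mem (Finset.mem_range.mpr hi),
        Finset.card_range]
      omega)
    (by
      rw [Finset.card_sdiff_of_subset hAI, Nat.cast_sub (Finset.card_le_card hAI), nsmul_eq_mul]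
      have hle : (((Finset.range k).erase i).card : ℝ) ≤ k := by
        exact_mod_cast (Finset.card_erase_le).trans (Finset.card_range k).le
      linarith [mul_le_mul_of_nonneg_right hle hb0])
  rw [Finset.mem_erase, Finset.mem_range] at hj
  obtain ⟨σ, hσ, hσi, hσj⟩ := exists_perm_last_two hi hj.2 hj.1
  refine ⟨σ ∘ C, hC.comp_perm hσ, fun y hy => ?_⟩
  obtain ⟨T, hT, rfl⟩ := Finset.exists_subset_card_eq
    (Nat.cast_le.mp (hy.le.trans hbj) : y ≤ _)
  have hT' : ∀ v ∈ T, v ∈ I \ A ∧ C v = j := fun v hv => Finset.mem_filter.mp (hT hv)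
  obtain ⟨φ', hφ', hφ'eq, hφ'card⟩ := (hC.comp_perm hσ).exists_move (a := k - 1) (b := k - 2)
    (by omega) (by omega) hI
    (fun v hv => hAI (Finset.mem_filter.mpr
      ⟨Finset.mem_univ v, σ.injective (hv.trans hσi.symm)⟩))
    (fun v hv => (Finset.mem_sdiff.mp (hT' v hv).1).1)
    (fun v hv => (congrArg σ (hT' v hv).2).trans hσj)
  exact ⟨φ', hφ', fun i hi => hφ'eq i (by omega) (by omega), hφ'card⟩

end Paper
end
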